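/- Let p>1 and ω>0, and set c = (p+3)ω/4 and, for m ∈ ℕ, r̄_m = 2m/√((p−1)ω). Then there exist m* ∈ ℕ and C>0 such that for every integer m ≥ m* and every φ ∈ C²((0,∞), ℝ) with φ(r) > 0 for all r > 0 satisfying φ''(r) + φ'(r)/r − (ω + m²/r²)·φ(r) + φ(r)^p = 0 on (0,∞), the limits lim_{r→0} φ(r)/r^m and lim_{r→0} φ'(r)/(m r^{m−1}) existing, finite and equal, and lim_{r→∞} φ(r) = 0, one has sup_{r>0} | φ(r) − Q_c(r − r̄_m) | ≤ C/m. -/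

import Mathlib

open MeasureTheory Real Filter

/-- The 1D soliton profile `Q_c`. -/
noncomputable def Qc (p c : ℝ) : ℝ → ℝ := fun x =>
  ((p + 1) * c / 2) ^ (1 / (p - 1)) *
    (1 / Real.cosh ((p - 1) * Real.sqrt c * x / 2)) ^ (2 / (p - 1))

/-! ### One-variable calculus -/

lemma le_of_hasDerivAt_nonneg {f f' : ℝ → ℝ} {a b : ℝ} (hab : a ≤ b)
    (hd : ∀ x ∈ Set.Icc a b, HasDerivAt f (f' x) x) (hn : ∀ x ∈ Set.Icc a b, 0 ≤ f' x) :
    f a ≤ f b := by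
  rcases hab.eq_or_lt with rfl | hab
  · exact le_rfl
  obtain ⟨c, hc, h⟩ := exists_hasDerivAt_eq_slope f f' hab
    (fun x hx => (hd x hx).continuousAt.continuousWithinAt)
    (fun x hx => hd x (Set.Ioo_subset_Icc_self hx))
  have h1 := hn c (Set.Ioo_subset_Icc_self hc)
  rw [h] at h1
  have h2 : 0 < b - a := sub_pos.2 hab
  have h3 : 0 ≤ f b - f a := by
    by_contra h4
    exact absurd h1 (not_le.2 (div_neg_of_neg_of_pos (not_le.1 h4) h2))
  linarith

lemma ge_of_hasDerivAt_nonpos {f f' : ℝ → ℝ} {a b : ℝ} (hab : a ≤ b)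
    (hd : ∀ x ∈ Set.Icc a b, HasDerivAt f (f' x) x) (hn : ∀ x ∈ Set.Icc a b, f' x ≤ 0) :
    f b ≤ f a := by
  have := le_of_hasDerivAt_nonneg (f := fun x => -f x) (f' := fun x => -f' x) hab
    (fun x hx => (hd x hx).neg) (fun x hx => by have := hn x hx; simpa using this)
  simpa using this

lemma le_taylor_of_second_deriv_le {f f' f'' : ℝ → ℝ} {a b C : ℝ} (hab : a ≤ b)
    (hd : ∀ x ∈ Set.Icc a b, HasDerivAt f (f' x) x)
    (hd' : ∀ x ∈ Set.Icc a b, HasDerivAt f' (f'' x) x)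
    (hC : ∀ x ∈ Set.Icc a b, f'' x ≤ C) :
    f b ≤ f a + f' a * (b - a) + C * (b - a) ^ 2 / 2 := by
  have h1 : ∀ x ∈ Set.Icc a b, f' x ≤ f' a + C * (x - a) := by
    intro x hx
    have := ge_of_hasDerivAt_nonpos (f := fun y => f' y - C * (y - a))
      (f' := fun y => f'' y - C * 1) hx.1
      (fun y hy => (hd' y ⟨hy.1, hy.2.trans hx.2⟩).sub
        (((hasDerivAt_id y).sub_const a).const_mul C))
      (fun y hy => by have := hC y ⟨hy.1, hy.2.trans hx.2⟩; simpa using this)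
    simp only [sub_self, mul_zero, sub_zero] at this
    linarith
  have := ge_of_hasDerivAt_nonpos
    (f := fun y => f y - (f' a * (y - a) + C * (y - a) ^ 2 / 2))
    (f' := fun y => f' y - (f' a * 1 + C * (2 * (y - a) ^ 1 * 1) / 2)) hab
    (fun y hy => (hd y hy).sub ((((hasDerivAt_id y).sub_const a).const_mul (f' a)).add
      ((((((hasDerivAt_id y).sub_const a).pow 2).const_mul C).div_const 2))))
    (fun y hy => by have := h1 y hy; simp only [pow_one]; linarith)
  simp only [sub_self, mul_zero] at this
  nlinarith [this]

lemma IsLocalMax.second_hasDerivAt_nonpos {f f' : ℝ → ℝ} {c F : ℝ} (hmax : IsLocalMax f c)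
    (hd : ∀ᶠ x in nhds c, HasDerivAt f (f' x) x) (hd' : HasDerivAt f' F c) : F ≤ 0 := by
  by_contra hF
  have hdd : deriv f =ᶠ[nhds c] f' := hd.mono fun x hx => hx.deriv
  have h2 : deriv (deriv f) c = F := by rw [hdd.deriv_eq]; exact hd'.deriv
  have hmin : IsLocalMin f c := isLocalMin_of_deriv_deriv_pos (by rw [h2]; exact not_le.1 hF)
    hmax.deriv_eq_zero hd.self_of_nhds.continuousAt
  have hconst : f =ᶠ[nhds c] fun _ => f c := by
    filter_upwards [hmin, hmax] with x h1 h2 using le_antisymm h2 h1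
  have h3 : deriv f =ᶠ[nhds c] fun _ => 0 := by
    simpa using hconst.deriv
  have h4 : deriv (deriv f) c = 0 := by rw [h3.deriv_eq]; simp
  rw [h2] at h4
  exact hF h4.le

/-- One-dimensional maximum principle. -/
lemma le_of_second_deriv_pos {f f' f'' : ℝ → ℝ} {a b D : ℝ}
    (hd : ∀ x ∈ Set.Icc a b, HasDerivAt f (f' x) x)
    (hd' : ∀ x ∈ Set.Icc a b, HasDerivAt f' (f'' x) x)
    (ha : f a ≤ D) (hb : f b ≤ D) (hpos : ∀ x ∈ Set.Icc a b, D < f x → f' x = 0 → 0 < f'' x) :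
    ∀ x ∈ Set.Icc a b, f x ≤ D := by
  intro x hx
  have hcont : ContinuousOn f (Set.Icc a b) :=
    fun y hy => (hd y hy).continuousAt.continuousWithinAt
  obtain ⟨c, hc, hmax⟩ := isCompact_Icc.exists_isMaxOn ⟨x, hx⟩ hcont
  by_contra hlt
  have hDc : D < f c := (not_le.1 hlt).trans_le (hmax hx)
  have hca : c ≠ a := by rintro rfl; linarith
  have hcb : c ≠ b := by rintro rfl; linarith
  have hio : c ∈ Set.Ioo a b := ⟨lt_of_le_of_ne hc.1 hca.symm, lt_of_le_of_ne hc.2 hcb⟩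
  have hnhds : Set.Icc a b ∈ nhds c := Icc_mem_nhds hio.1 hio.2
  have := IsLocalMax.second_hasDerivAt_nonpos (hmax.isLocalMax hnhds)
    (by filter_upwards [hnhds] with y hy using hd y hy) (hd' c hc)
  exact absurd (hpos c hc hDc ((hmax.isLocalMax hnhds).hasDerivAt_eq_zero (hd c hc)))
    (not_lt.2 this)

lemma abs_rpow_sub_rpow_le {p M a b : ℝ} (hp : 1 ≤ p) (ha : a ∈ Set.Icc 0 M)
    (hb : b ∈ Set.Icc 0 M) : |a ^ p - b ^ p| ≤ p * M ^ (p - 1) * |a - b| := by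
  have := (convex_Icc (0 : ℝ) M).norm_image_sub_le_of_norm_hasDerivWithin_le
    (f := fun x => x ^ p) (f' := fun x => p * x ^ (p - 1)) (C := p * M ^ (p - 1))
    (fun x _ => (hasDerivAt_rpow_const (Or.inr hp)).hasDerivWithinAt)
    (fun x hx => by
      rw [Real.norm_eq_abs, abs_of_nonneg (by have := hx.1; positivity)]
      have := rpow_le_rpow hx.1 hx.2 (by linarith : 0 ≤ p - 1)
      gcongr) hb ha
  simpa [Real.norm_eq_abs] using this

/-- Near `1`, a real power agrees with its tangent line up to a quadratic error. -/
lemma exists_rpow_taylor (s : ℝ) : ∃ C > 0, ∀ X ∈ Set.Icc (1 / 2 : ℝ) (3 / 2),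
    X ^ s ≤ C ∧ |X ^ s - 1| ≤ C * |X - 1| ∧ |X ^ s - 1 - s * (X - 1)| ≤ C * (X - 1) ^ 2 := by
  have hb : ∀ t : ℝ, ∃ C > 0, ∀ X ∈ Set.Icc (1 / 2 : ℝ) (3 / 2), |X ^ t| ≤ C := by
    intro t
    have hc : ContinuousOn (fun X : ℝ => X ^ t) (Set.Icc (1 / 2 : ℝ) (3 / 2)) := fun X hX =>
      (continuousAt_rpow_const X t (Or.inl (by have := hX.1; positivity))).continuousWithinAt
    obtain ⟨C, hC⟩ := isCompact_Icc.exists_bound_of_continuousOn hc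
    exact ⟨|C| + 1, by positivity, fun X hX => by
      have := hC X hX; rw [Real.norm_eq_abs] at this; linarith [le_abs_self C]⟩
  have hd : ∀ t : ℝ, ∀ X ∈ Set.Icc (1 / 2 : ℝ) (3 / 2),
      HasDerivAt (fun X : ℝ => X ^ t) (t * X ^ (t - 1)) X := fun t X hX =>
    hasDerivAt_rpow_const (Or.inl (by have := hX.1; intro h; rw [h] at this; norm_num at this))
  have hl : ∀ t : ℝ, ∃ C > 0, ∀ X ∈ Set.Icc (1 / 2 : ℝ) (3 / 2), |X ^ t - 1| ≤ C * |X - 1| := by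
    intro t
    obtain ⟨C, hC, h⟩ := hb (t - 1)
    refine ⟨|t| * C + 1, by positivity, fun X hX => ?_⟩
    have := (convex_Icc (1 / 2 : ℝ) (3 / 2)).norm_image_sub_le_of_norm_hasDerivWithin_le
      (f := fun X : ℝ => X ^ t) (C := |t| * C + 1)
      (fun Y hY => (hd t Y hY).hasDerivWithinAt)
      (fun Y hY => by
        rw [norm_mul, Real.norm_eq_abs, Real.norm_eq_abs]
        have := mul_le_mul_of_nonneg_left (h Y hY) (abs_nonneg t); linarith)
      (x := 1) (y := X) ⟨by norm_num, by norm_num⟩ hX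
    simpa [Real.norm_eq_abs] using this
  obtain ⟨C1, hC1, h1⟩ := hb s
  obtain ⟨C2, hC2, h2⟩ := hl s
  obtain ⟨C3, hC3, h3⟩ := hl (s - 1)
  refine ⟨C1 + C2 + |s| * C3, by positivity, fun X hX => ⟨?_, ?_, ?_⟩⟩
  · have := (le_abs_self _).trans (h1 X hX)
    have : 0 ≤ |s| * C3 := by positivity
    linarith
  · refine (h2 X hX).trans (mul_le_mul_of_nonneg_right ?_ (abs_nonneg _))
    have : 0 ≤ |s| * C3 := by positivity
    linarith
  · have hsub : Set.uIcc 1 X ⊆ Set.Icc (1 / 2 : ℝ) (3 / 2) :=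
      Set.uIcc_subset_Icc ⟨by norm_num, by norm_num⟩ hX
    have := (convex_uIcc (1 : ℝ) X).norm_image_sub_le_of_norm_hasDerivWithin_le
      (f := fun Y : ℝ => Y ^ s - s * (Y - 1)) (f' := fun Y => s * Y ^ (s - 1) - s * 1)
      (C := |s| * C3 * |X - 1|)
      (fun Y hY => ((hd s Y (hsub hY)).sub
        (((hasDerivAt_id Y).sub_const 1).const_mul s)).hasDerivWithinAt)
      (fun Y hY => by
        have e : s * Y ^ (s - 1) - s * 1 = s * (Y ^ (s - 1) - 1) := by ring
        rw [e, norm_mul, Real.norm_eq_abs, Real.norm_eq_abs, mul_assoc]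
        have h5 : |Y - 1| ≤ |X - 1| := Set.abs_sub_left_of_mem_uIcc hY
        have := h3 Y (hsub hY)
        gcongr
        exact this.trans (by gcongr))
      (Set.left_mem_uIcc) (Set.right_mem_uIcc)
    simp only [Real.norm_eq_abs, sub_self, mul_zero, sub_zero, one_rpow] at this
    have e : X ^ s - s * (X - 1) - 1 = X ^ s - 1 - s * (X - 1) := by ring
    rw [e] at this
    refine this.trans ?_
    rw [mul_assoc, ← sq, sq_abs]
    refine mul_le_mul_of_nonneg_right ?_ (sq_nonneg _)
    linarith

lemma exists_pow_mul_exp_neg_le (k : ℕ) {α : ℝ} (hα : 0 < α) :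
    ∃ C > 0, ∀ x : ℝ, 0 ≤ x → x ^ k * exp (-(α * x)) ≤ C := by
  refine ⟨k.factorial / α ^ k, by positivity, fun x hx => ?_⟩
  have h := pow_div_factorial_le_exp (α * x) (by positivity) k
  rw [exp_neg, ← div_eq_mul_inv, div_le_div_iff₀ (exp_pos _) (by positivity)]
  rw [div_le_iff₀ (by positivity), mul_pow] at h
  linarith

/-! ### The soliton -/

lemma Qc_one_eq (p x : ℝ) : Qc p 1 x =
    ((p + 1) / 2) ^ (1 / (p - 1)) * (cosh ((p - 1) / 2 * x)) ^ (-(2 / (p - 1))) := by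
  have e : (p - 1) * √1 * x / 2 = (p - 1) / 2 * x := by rw [sqrt_one]; ring
  rw [Qc, e, mul_one, rpow_neg (cosh_pos _).le, one_div (cosh _), inv_rpow (cosh_pos _).le]

lemma Qc_eq_scaling {p c : ℝ} (hp : 1 < p) (hc : 0 < c) (x : ℝ) :
    Qc p c x = c ^ (1 / (p - 1)) * Qc p 1 (√c * x) := by
  have e : (p - 1) * √1 * (√c * x) / 2 = (p - 1) * √c * x / 2 := by rw [sqrt_one]; ring
  simp only [Qc]
  rw [e, show (p + 1) * c / 2 = c * ((p + 1) * 1 / 2) by ring,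
    mul_rpow hc.le (by linarith), mul_assoc]

lemma Qc_one_pos {p : ℝ} (hp : 1 < p) (x : ℝ) : 0 < Qc p 1 x := by
  rw [Qc_one_eq]
  have := cosh_pos ((p - 1) / 2 * x)
  have : 0 < (p + 1) / 2 := by linarith
  positivity

lemma Qc_one_neg (p x : ℝ) : Qc p 1 (-x) = Qc p 1 x := by
  rw [Qc_one_eq, Qc_one_eq, mul_neg, cosh_neg]

lemma Qc_one_le_of_abs_le {p x y : ℝ} (hp : 1 < p) (h : |x| ≤ |y|) : Qc p 1 y ≤ Qc p 1 x := by
  rw [Qc_one_eq, Qc_one_eq]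
  refine mul_le_mul_of_nonneg_left ?_ (rpow_nonneg (by linarith) _)
  refine rpow_le_rpow_of_nonpos (cosh_pos _) ?_ ?_
  · rw [cosh_le_cosh, abs_mul, abs_mul]
    exact mul_le_mul_of_nonneg_left h (abs_nonneg _)
  · have : 0 < 2 / (p - 1) := div_pos two_pos (by linarith)
    linarith

lemma Qc_one_zero_rpow {p : ℝ} (hp : 1 < p) : Qc p 1 0 ^ (p - 1) = (p + 1) / 2 := by
  rw [Qc_one_eq, mul_zero, cosh_zero, one_rpow, mul_one, ← rpow_mul (by linarith),
    one_div, inv_mul_cancel₀ (by linarith), rpow_one]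

lemma Qc_one_rpow {p : ℝ} (hp : 1 < p) (x : ℝ) :
    Qc p 1 x ^ p = Qc p 1 x * ((p + 1) / 2 * (1 - tanh ((p - 1) / 2 * x) ^ 2)) := by
  have hc := cosh_pos ((p - 1) / 2 * x)
  have hp1 : p - 1 ≠ 0 := by linarith
  have h1 : Qc p 1 x ^ p = Qc p 1 x * Qc p 1 x ^ (p - 1) := by
    rw [rpow_sub_one (Qc_one_pos hp x).ne', mul_div_cancel₀ _ (Qc_one_pos hp x).ne']
  have h2 : Qc p 1 x ^ (p - 1) = (p + 1) / 2 * (1 - tanh ((p - 1) / 2 * x) ^ 2) := by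
    have e : 1 - tanh ((p - 1) / 2 * x) ^ 2 = (cosh ((p - 1) / 2 * x)) ^ (-2 : ℝ) := by
      rw [rpow_neg hc.le, rpow_two, tanh_eq_sinh_div_cosh, div_pow, sinh_sq]
      field_simp
      ring
    rw [e, Qc_one_eq, mul_rpow (rpow_nonneg (by linarith) _) (rpow_nonneg hc.le _),
      ← rpow_mul (by linarith), ← rpow_mul hc.le]
    congr 2
    · rw [one_div, inv_mul_cancel₀ hp1, rpow_one]
    · field_simp
  rw [h1, h2]

lemma hasDerivAt_Qc_one {p : ℝ} (hp : 1 < p) (x : ℝ) :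
    HasDerivAt (Qc p 1) (-(Qc p 1 x * tanh ((p - 1) / 2 * x))) x := by
  have hc := cosh_pos ((p - 1) / 2 * x)
  have hp1 : p - 1 ≠ 0 := by linarith
  have h : HasDerivAt (fun y => cosh ((p - 1) / 2 * y))
      (sinh ((p - 1) / 2 * x) * ((p - 1) / 2 * 1)) x :=
    (hasDerivAt_cosh _).comp x ((hasDerivAt_id x).const_mul _)
  have h2 := (h.rpow_const (p := -(2 / (p - 1))) (Or.inl hc.ne')).const_mul
    (((p + 1) / 2) ^ (1 / (p - 1)))
  have e : Qc p 1 = fun x => ((p + 1) / 2) ^ (1 / (p - 1)) *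
    (cosh ((p - 1) / 2 * x)) ^ (-(2 / (p - 1))) := funext (Qc_one_eq p)
  rw [e]
  refine h2.congr_deriv ?_
  rw [rpow_sub_one hc.ne', tanh_eq_sinh_div_cosh]
  field_simp

lemma hasDerivAt_deriv_Qc_one {p : ℝ} (hp : 1 < p) (x : ℝ) :
    HasDerivAt (fun x => -(Qc p 1 x * tanh ((p - 1) / 2 * x))) (Qc p 1 x - Qc p 1 x ^ p) x := by
  have ht : HasDerivAt (fun y => tanh ((p - 1) / 2 * y))
      ((1 - tanh ((p - 1) / 2 * x) ^ 2) * ((p - 1) / 2 * 1)) x := by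
    have hc := cosh_pos ((p - 1) / 2 * x)
    have h0 : HasDerivAt tanh (1 - tanh ((p - 1) / 2 * x) ^ 2) ((p - 1) / 2 * x) := by
      have := (hasDerivAt_sinh ((p - 1) / 2 * x)).div (hasDerivAt_cosh _) hc.ne'
      have e : tanh = sinh / cosh := funext fun y => by
        rw [Pi.div_apply, tanh_eq_sinh_div_cosh]
      rw [e]
      refine this.congr_deriv ?_
      simp only [Pi.div_apply]
      field_simp
    exact h0.comp x ((hasDerivAt_id x).const_mul _)
  refine ((hasDerivAt_Qc_one hp x).mul ht).neg.congr_deriv ?_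
  rw [Qc_one_rpow hp]
  ring

lemma abs_tanh_le_one (x : ℝ) : |tanh x| ≤ 1 := (abs_tanh_lt_one x).le

lemma exists_Qc_one_le_exp {p : ℝ} (hp : 1 < p) :
    ∃ K > 0, ∀ x, Qc p 1 x ≤ K * exp (-|x|) := by
  have hp1 : 0 < p - 1 := by linarith
  refine ⟨((p + 1) / 2) ^ (1 / (p - 1)) * 2 ^ (2 / (p - 1)), by positivity, fun x => ?_⟩
  rw [Qc_one_eq, mul_assoc]
  refine mul_le_mul_of_nonneg_left ?_ (rpow_nonneg (by linarith) _)
  have h1 : exp ((p - 1) / 2 * |x|) / 2 ≤ cosh ((p - 1) / 2 * x) := by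
    rw [← cosh_abs, abs_mul, abs_of_pos (by linarith : 0 < (p - 1) / 2), cosh_eq]
    have := exp_pos (-((p - 1) / 2 * |x|))
    linarith
  calc _ ≤ (exp ((p - 1) / 2 * |x|) / 2) ^ (-(2 / (p - 1))) :=
        rpow_le_rpow_of_nonpos (by positivity) h1 (by
          have : 0 < 2 / (p - 1) := div_pos two_pos hp1
          linarith)
    _ = 2 ^ (2 / (p - 1)) * exp (-|x|) := by
        rw [div_rpow (exp_pos _).le two_pos.le, rpow_neg two_pos.le, ← exp_mul]
        have e : (p - 1) / 2 * |x| * -(2 / (p - 1)) = -|x| := by field_simp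
        rw [e, div_inv_eq_mul, mul_comm]

/-! ### Decaying solutions on a half line with slowly varying potential -/

/-- A positive nonincreasing solution of `U'' = h U - U ^ p` on `[0, B]` with nonnegative energy,
where the potential `h` has slope at most `δ`. -/
structure HalfProfile (p δ B : ℝ) (h h1 U U1 : ℝ → ℝ) : Prop where
  one_lt : 1 < p
  delta_pos : 0 < δ
  delta_mul : δ * B = (p - 1) / (8 * (p + 1))
  hasDerivAt_U : ∀ x ∈ Set.Icc 0 B, HasDerivAt U (U1 x) x
  hasDerivAt_U1 : ∀ x ∈ Set.Icc 0 B, HasDerivAt U1 (h x * U x - U x ^ p) x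
  hasDerivAt_h : ∀ x ∈ Set.Icc 0 B, HasDerivAt h (h1 x) x
  abs_h1_le : ∀ x ∈ Set.Icc 0 B, |h1 x| ≤ δ
  h_zero : h 0 = 1
  pos : ∀ x ∈ Set.Icc 0 B, 0 < U x
  U1_zero : U1 0 = 0
  U1_nonpos : ∀ x ∈ Set.Icc 0 B, U1 x ≤ 0
  energy_nonneg : ∀ x ∈ Set.Icc 0 B, 0 ≤ U1 x ^ 2 / 2 - h x * U x ^ 2 / 2 + U x ^ (p + 1) / (p + 1)

lemma rpow_eq_mul_rpow_sub_one {u p : ℝ} (hu : 0 < u) : u ^ p = u * u ^ (p - 1) := by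
  rw [rpow_sub_one hu.ne', mul_div_cancel₀ _ hu.ne']

lemma rpow_add_one_eq {u p : ℝ} (hu : 0 < u) : u ^ (p + 1) = u ^ 2 * u ^ (p - 1) := by
  rw [rpow_sub_one hu.ne', rpow_add_one hu.ne']
  field_simp

lemma hasDerivAt_energy {p : ℝ} (hp : 1 < p) {h U U1 : ℝ → ℝ} {h1 x : ℝ}
    (hU : HasDerivAt U (U1 x) x) (hU1 : HasDerivAt U1 (h x * U x - U x ^ p) x)
    (hh : HasDerivAt h h1 x) :
    HasDerivAt (fun x => U1 x ^ 2 / 2 - h x * U x ^ 2 / 2 + U x ^ (p + 1) / (p + 1))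
      (-(h1 * U x ^ 2 / 2)) x := by
  have h3 := hU.rpow_const (p := p + 1) (Or.inr (by linarith))
  refine ((((hU1.pow 2).div_const 2).sub ((hh.mul (hU.pow 2)).div_const 2)).add
    (h3.div_const (p + 1))).congr_deriv ?_
  have : p + 1 ≠ 0 := by linarith
  simp only [add_sub_cancel_right, Nat.cast_ofNat, Nat.add_one_sub_one, pow_one, Pi.pow_apply]
  field_simp
  ring

namespace HalfProfile

variable {p δ B : ℝ} {h h1 U U1 : ℝ → ℝ}

lemma B_pos (H : HalfProfile p δ B h h1 U U1) : 0 < B := by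
  have h1 := H.one_lt
  have : 0 < δ * B := by rw [H.delta_mul]; exact div_pos (by linarith) (by linarith)
  exact (pos_iff_pos_of_mul_pos this).1 H.delta_pos

lemma abs_h_sub_one_le (H : HalfProfile p δ B h h1 U U1) {x : ℝ} (hx : x ∈ Set.Icc 0 B) :
    |h x - 1| ≤ δ * x := by
  have := (convex_Icc 0 B).norm_image_sub_le_of_norm_hasDerivWithin_le
    (fun y hy => (H.hasDerivAt_h y hy).hasDerivWithinAt) H.abs_h1_le
    (Set.left_mem_Icc.2 H.B_pos.le) hx
  rwa [H.h_zero, Real.norm_eq_abs, sub_zero, Real.norm_eq_abs, abs_of_nonneg hx.1] at this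

lemma delta_mul_le (H : HalfProfile p δ B h h1 U U1) {x : ℝ} (hx : x ∈ Set.Icc 0 B) :
    δ * x ≤ (p - 1) / (8 * (p + 1)) := by
  rw [← H.delta_mul]; exact mul_le_mul_of_nonneg_left hx.2 H.delta_pos.le

lemma h_bounds (H : HalfProfile p δ B h h1 U U1) {x : ℝ} (hx : x ∈ Set.Icc 0 B) :
    1 - (p - 1) / (8 * (p + 1)) ≤ h x ∧ h x ≤ 1 + (p - 1) / (8 * (p + 1)) := by
  have h1 := abs_le.1 (H.abs_h_sub_one_le hx)
  have h2 := H.delta_mul_le hx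
  constructor <;> linarith [h1.1, h1.2]

lemma h_le (H : HalfProfile p δ B h h1 U U1) {x : ℝ} (hx : x ∈ Set.Icc 0 B) :
    1 / 2 ≤ h x ∧ h x ≤ 3 / 2 := by
  have h1 := H.h_bounds hx
  have h2 := H.one_lt
  have h3 : (p - 1) / (8 * (p + 1)) ≤ 1 / 2 := by
    rw [div_le_div_iff₀ (by linarith) two_pos]; linarith
  constructor <;> linarith [h1.1, h1.2]

lemma antitone (H : HalfProfile p δ B h h1 U U1) {x y : ℝ} (hx : 0 ≤ x) (hxy : x ≤ y)
    (hy : y ≤ B) : U y ≤ U x :=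
  ge_of_hasDerivAt_nonpos hxy (fun z hz => H.hasDerivAt_U z ⟨hx.trans hz.1, hz.2.trans hy⟩)
    (fun z hz => H.U1_nonpos z ⟨hx.trans hz.1, hz.2.trans hy⟩)

end HalfProfile

lemma exists_halfProfile_zero_le {p : ℝ} (hp : 1 < p) : ∃ M > 0,
    ∀ (δ B : ℝ) (h h1 U U1 : ℝ → ℝ), HalfProfile p δ B h h1 U U1 → 2 ≤ B → U 0 ≤ M := by
  have hp1 : 0 < p - 1 := by linarith
  refine ⟨2 * 34 ^ (1 / (p - 1)), by positivity, fun δ B h h1 U U1 H hB => ?_⟩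
  by_contra hM
  rw [not_le] at hM
  have h0 : (0 : ℝ) ∈ Set.Icc 0 B := ⟨le_rfl, by linarith⟩
  have hU0 := H.pos 0 h0
  have hquarter : U (1 / 4) ≤ U 0 / 2 := by
    by_contra hlt
    rw [not_le] at hlt
    have := le_taylor_of_second_deriv_le (f := U) (f' := U1) (a := 0) (b := 1 / 4)
      (C := -16 * U 0) (by norm_num)
      (fun x hx => H.hasDerivAt_U x ⟨hx.1, by linarith [hx.2]⟩)
      (fun x hx => H.hasDerivAt_U1 x ⟨hx.1, by linarith [hx.2]⟩)
      (fun x hx => by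
        have hxB : x ∈ Set.Icc 0 B := ⟨hx.1, by linarith [hx.2]⟩
        have hUx : U 0 / 2 ≤ U x :=
          hlt.le.trans (H.antitone hx.1 hx.2 (by linarith))
        have h34 : 34 ≤ U x ^ (p - 1) := by
          have : (34 : ℝ) ^ (1 / (p - 1)) ≤ U x := by linarith
          have := rpow_le_rpow (by positivity) this hp1.le
          rwa [← rpow_mul (by norm_num), one_div, inv_mul_cancel₀ hp1.ne', rpow_one] at this
        rw [rpow_eq_mul_rpow_sub_one (H.pos x hxB)]
        have := (H.h_le hxB).2
        nlinarith [H.pos x hxB])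
    rw [H.U1_zero] at this
    linarith
  obtain ⟨ξ, hξ, hs⟩ := exists_hasDerivAt_eq_slope U U1 (a := 0) (b := 1 / 4) (by norm_num)
    (fun x hx => (H.hasDerivAt_U x ⟨hx.1, by linarith [hx.2]⟩).continuousAt.continuousWithinAt)
    (fun x hx => H.hasDerivAt_U x ⟨hx.1.le, by linarith [hx.2]⟩)
  have hslope : U1 ξ ≤ -2 * U 0 := by
    have e : (U (1 / 4) - U 0) / (1 / 4 - 0) = 4 * (U (1 / 4) - U 0) := by ring
    rw [hs, e]; linarith
  have hB' : ∀ x ∈ Set.Icc ξ (ξ + 1), x ∈ Set.Icc 0 B := fun x hx =>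
    ⟨hξ.1.le.trans hx.1, by linarith [hx.2, hξ.2]⟩
  have := le_taylor_of_second_deriv_le (f := U) (f' := U1) (a := ξ) (b := ξ + 1)
    (C := 3 / 2 * U 0) (by linarith)
    (fun x hx => H.hasDerivAt_U x (hB' x hx)) (fun x hx => H.hasDerivAt_U1 x (hB' x hx))
    (fun x hx => by
      have h2 := (H.h_le (hB' x hx)).2
      have h3 := H.pos x (hB' x hx)
      have h4 := H.antitone le_rfl (hB' x hx).1 (hB' x hx).2
      have : 0 ≤ U x ^ p := by positivity
      nlinarith)
  have h5 := H.antitone le_rfl hξ.1.le (hB' ξ ⟨le_rfl, by linarith⟩).2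
  have h6 := H.pos (ξ + 1) (hB' _ ⟨by linarith, le_rfl⟩)
  nlinarith

lemma exists_halfProfile_le_exp {p : ℝ} (hp : 1 < p) : ∃ K > 0, ∃ α > 0, ∃ Y > 0,
    ∀ (δ B : ℝ) (h h1 U U1 : ℝ → ℝ), HalfProfile p δ B h h1 U U1 → Y ≤ B →
      ∀ x ∈ Set.Icc 0 B, U x ≤ K * exp (-(α * x)) := by
  have hp1 : 0 < p - 1 := by linarith
  obtain ⟨M, hM, hUM⟩ := exists_halfProfile_zero_le hp
  obtain ⟨u, hu⟩ : ∃ u, u = ((p + 3) / 4) ^ (1 / (p - 1)) := ⟨_, rfl⟩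
  have hu0 : 0 < u := by rw [hu]; positivity
  have hup : u ^ (p - 1) = (p + 3) / 4 := by
    rw [hu, ← rpow_mul (by linarith), one_div, inv_mul_cancel₀ hp1.ne', rpow_one]
  obtain ⟨c, hc⟩ : ∃ c, c = (p - 1) / 8 * u := ⟨_, rfl⟩
  have hc0 : 0 < c := by rw [hc]; positivity
  obtain ⟨X, hX⟩ : ∃ X, X = 2 + 2 * M / c := ⟨_, rfl⟩
  have hX2 : 2 ≤ X := by rw [hX]; have : 0 < 2 * M / c := by positivity
                         linarith
  have hd : 0 < (p - 1) / (4 * (p + 1)) := by positivity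
  obtain ⟨α, hα⟩ : ∃ α, α = √((p - 1) / (4 * (p + 1))) := ⟨_, rfl⟩
  have hα0 : 0 < α := by rw [hα]; exact sqrt_pos.2 hd
  have hα2 : α ^ 2 = (p - 1) / (4 * (p + 1)) := by rw [hα, sq_sqrt hd.le]
  refine ⟨M * exp (α * X), by positivity, α, hα0, X, by linarith,
    fun δ B h h1 U U1 H hXB x hx => ?_⟩
  have hU0 := hUM δ B h h1 U U1 H (hX2.trans hXB)
  have hUX : U X ≤ u := by
    by_contra hlt
    rw [not_le] at hlt
    have := le_taylor_of_second_deriv_le (f := U) (f' := U1) (a := 0) (b := X)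
      (C := -c) (by linarith)
      (fun x hx => H.hasDerivAt_U x ⟨hx.1, by linarith [hx.2]⟩)
      (fun x hx => H.hasDerivAt_U1 x ⟨hx.1, by linarith [hx.2]⟩)
      (fun x hx => by
        have hxB : x ∈ Set.Icc 0 B := ⟨hx.1, by linarith [hx.2]⟩
        have hUx : u ≤ U x := hlt.le.trans (H.antitone hx.1 hx.2 hXB)
        have h34 : (p + 3) / 4 ≤ U x ^ (p - 1) := by
          rw [← hup]; exact rpow_le_rpow hu0.le hUx hp1.le
        rw [rpow_eq_mul_rpow_sub_one (H.pos x hxB), hc]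
        have h5 := (H.h_bounds hxB).2
        have h6 : (p - 1) / (8 * (p + 1)) ≤ (p - 1) / 8 := by
          gcongr; linarith
        have h7 : h x - U x ^ (p - 1) ≤ -((p - 1) / 8) := by linarith
        have h8 := H.pos x hxB
        nlinarith)
    rw [H.U1_zero] at this
    have h9 := H.pos X ⟨by linarith, hXB⟩
    have h10 : c * X ^ 2 ≥ 4 * M := by
      have e : c * X = 2 * c + 2 * M := by rw [hX]; field_simp
      nlinarith
    linarith
  have hexp : ∀ y, X ≤ y → y ≤ B → U y ≤ M * exp (α * X) * exp (-(α * y)) := by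
    intro y hXy hyB
    have := ge_of_hasDerivAt_nonpos (f := fun z => U z * exp (α * z))
      (f' := fun z => U1 z * exp (α * z) + U z * (exp (α * z) * (α * 1))) hXy
      (fun z hz => (H.hasDerivAt_U z ⟨by linarith [hz.1], by linarith [hz.2]⟩).mul
        ((hasDerivAt_id z).const_mul α).exp)
      (fun z hz => by
        have hzB : z ∈ Set.Icc 0 B := ⟨by linarith [hz.1], by linarith [hz.2]⟩
        have hUz : U z ≤ u := (H.antitone (by linarith) hz.1 hzB.2).trans hUX
        have hz0 := H.pos z hzB
        have h34 : U z ^ (p - 1) ≤ (p + 3) / 4 := by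
          rw [← hup]; exact rpow_le_rpow hz0.le hUz hp1.le
        have he := H.energy_nonneg z hzB
        rw [rpow_add_one_eq hz0] at he
        have h5 := (H.h_bounds hzB).1
        have h6 : U z ^ (p - 1) / (p + 1) ≤ (p + 3) / 4 / (p + 1) := by gcongr
        have h7 : α ^ 2 ≤ h z - 2 * (U z ^ (p - 1) / (p + 1)) := by
          have : α ^ 2 ≤ 1 - (p - 1) / (8 * (p + 1)) - 2 * ((p + 3) / 4 / (p + 1)) := by
            rw [hα2, ← sub_nonneg]
            have : 1 - (p - 1) / (8 * (p + 1)) - 2 * ((p + 3) / 4 / (p + 1))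
              - (p - 1) / (4 * (p + 1)) = (p - 1) / (8 * (p + 1)) := by field_simp; ring
            rw [this]; positivity
          linarith
        have h8 : (α * U z) ^ 2 ≤ U1 z ^ 2 := by
          have : U z ^ 2 * U z ^ (p - 1) / (p + 1) = U z ^ 2 * (U z ^ (p - 1) / (p + 1)) := by
            ring
          rw [this] at he
          have := mul_le_mul_of_nonneg_right h7 (sq_nonneg (U z))
          nlinarith
        have h9 : α * U z ≤ -U1 z := by
          have h10 := sq_le_sq.1 h8
          rwa [abs_of_pos (by positivity), abs_of_nonpos (H.U1_nonpos z hzB)] at h10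
        have := exp_pos (α * z)
        nlinarith)
    have h11 : U X ≤ M := (H.antitone le_rfl (by linarith) hXB).trans hU0
    rw [exp_neg, ← div_eq_mul_inv, le_div_iff₀ (exp_pos _)]
    exact this.trans (mul_le_mul_of_nonneg_right h11 (exp_pos _).le)
  rcases le_total X x with hXx | hxX
  · exact hexp x hXx hx.2
  · have h12 : U x ≤ M := (H.antitone le_rfl hx.1 hx.2).trans hU0
    rw [mul_assoc, ← exp_add]
    have : 1 ≤ exp (α * X + -(α * x)) := one_le_exp (by nlinarith)
    nlinarith

lemma exists_halfProfile_decay {p : ℝ} (hp : 1 < p) : ∃ K > 0, ∃ α > 0, ∃ δ₀ > 0, δ₀ ≤ 1 ∧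
    ∀ (δ B : ℝ) (h h1 U U1 : ℝ → ℝ), HalfProfile p δ B h h1 U U1 → δ ≤ δ₀ →
      2 ≤ B ∧ exp (-(α * B)) ≤ K * δ ^ 3 ∧ ∀ x ∈ Set.Icc 0 B, U x ≤ K * exp (-(α * x)) := by
  obtain ⟨K, hK, α, hα, Y, hY, hdec⟩ := exists_halfProfile_le_exp hp
  obtain ⟨C, hC, hexp⟩ := exists_pow_mul_exp_neg_le 3 hα
  obtain ⟨θ, hθ⟩ : ∃ θ, θ = (p - 1) / (8 * (p + 1)) := ⟨_, rfl⟩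
  have hθ0 : 0 < θ := by rw [hθ]; exact div_pos (by linarith) (by linarith)
  refine ⟨K + C / θ ^ 3, by positivity, α, hα, min (θ / (Y + 2)) 1, by positivity,
    min_le_right _ _, fun δ B h h1 U U1 H hδ => ?_⟩
  have hδ0 := H.delta_pos
  have hB0 := H.B_pos
  have hδB : δ * B = θ := by rw [H.delta_mul, hθ]
  have hYB : Y + 2 ≤ B := by
    have h1 := hδ.trans (min_le_left _ _)
    rw [le_div_iff₀ (by linarith), ← hδB] at h1
    exact le_of_mul_le_mul_left h1 hδ0
  refine ⟨by linarith, ?_, fun x hx => ?_⟩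
  · have h2 := hexp B hB0.le
    have e : C / θ ^ 3 * δ ^ 3 = C / B ^ 3 := by rw [← hδB, mul_pow]; field_simp
    rw [add_mul, e]
    have h3 : exp (-(α * B)) ≤ C / B ^ 3 := by
      rw [le_div_iff₀ (by positivity)]; linarith
    have : 0 < K * δ ^ 3 := by positivity
    linarith
  · refine (hdec δ B h h1 U U1 H (by linarith) x hx).trans ?_
    have : 0 < C / θ ^ 3 := by positivity
    exact mul_le_mul_of_nonneg_right (by linarith) (exp_pos _).le

lemma exists_halfProfile_energy_le {p : ℝ} (hp : 1 < p) : ∃ K > 0, ∃ δ₀ > 0,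
    ∀ (δ B : ℝ) (h h1 U U1 : ℝ → ℝ), HalfProfile p δ B h h1 U U1 → δ ≤ δ₀ →
      ∃ ξ ∈ Set.Icc (B - 1) B,
        U1 ξ ^ 2 / 2 - h ξ * U ξ ^ 2 / 2 + U ξ ^ (p + 1) / (p + 1) ≤ K * δ ^ 3 := by
  obtain ⟨K, hK, α, hα, δ₀, hδ₀, hδ₁, hdec⟩ := exists_halfProfile_decay hp
  refine ⟨(K * exp α * K) ^ 2 + K * exp α * K * K ^ p, by positivity, δ₀, hδ₀,
    fun δ B h h1 U U1 H hδ => ?_⟩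
  obtain ⟨hB, hB3, hU⟩ := hdec δ B h h1 U U1 H hδ
  have hδ0 := H.delta_pos
  have hsub : ∀ x ∈ Set.Icc (B - 1) B, x ∈ Set.Icc 0 B := fun x hx => ⟨by linarith [hx.1], hx.2⟩
  have hend : U (B - 1) ≤ K * exp α * K * δ ^ 3 := by
    refine (hU (B - 1) (hsub _ ⟨le_rfl, by linarith⟩)).trans ?_
    have e : exp (-(α * (B - 1))) = exp α * exp (-(α * B)) := by rw [← exp_add]; ring_nf
    rw [e]
    calc K * (exp α * exp (-(α * B))) ≤ K * (exp α * (K * δ ^ 3)) := by gcongr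
      _ = _ := by ring
  obtain ⟨ξ, hξ, hs⟩ := exists_hasDerivAt_eq_slope U U1 (a := B - 1) (b := B) (by linarith)
    (fun x hx => (H.hasDerivAt_U x (hsub x hx)).continuousAt.continuousWithinAt)
    (fun x hx => H.hasDerivAt_U x (hsub x ⟨hx.1.le, hx.2.le⟩))
  have hξ' : ξ ∈ Set.Icc (B - 1) B := ⟨hξ.1.le, hξ.2.le⟩
  have hξB := hsub ξ hξ'
  refine ⟨ξ, hξ', ?_⟩
  have hU1 : -U1 ξ ≤ K * exp α * K * δ ^ 3 := by
    rw [hs, sub_sub_cancel, div_one]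
    have := H.pos B (hsub B ⟨by linarith, le_rfl⟩)
    linarith
  have hξ0 := H.pos ξ hξB
  have hδ6 : δ ^ 3 ≤ 1 := pow_le_one₀ hδ0.le (by linarith)
  have h2 : U1 ξ ^ 2 ≤ (K * exp α * K) ^ 2 * δ ^ 3 := by
    have h3 := H.U1_nonpos ξ hξB
    have h4 : (-U1 ξ) ^ 2 ≤ (K * exp α * K * δ ^ 3) ^ 2 :=
      pow_le_pow_left₀ (by linarith) hU1 2
    rw [neg_sq, mul_pow] at h4
    refine h4.trans (mul_le_mul_of_nonneg_left ?_ (sq_nonneg _))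
    have : 0 < δ ^ 3 := by positivity
    nlinarith
  have hUξ : U ξ ≤ K * exp α * K * δ ^ 3 :=
    (H.antitone (by linarith) hξ.1.le hξ.2.le).trans hend
  have hUK : U ξ ≤ K := by
    refine (hU ξ hξB).trans ?_
    have : exp (-(α * ξ)) ≤ 1 := exp_le_one_iff.2 (by have := hξB.1; nlinarith)
    nlinarith
  have h5 : U ξ ^ (p + 1) / (p + 1) ≤ K * exp α * K * K ^ p * δ ^ 3 := by
    calc U ξ ^ (p + 1) / (p + 1) ≤ U ξ ^ (p + 1) := div_le_self (by positivity) (by linarith)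
      _ = U ξ * U ξ ^ p := by rw [rpow_add_one hξ0.ne', mul_comm]
      _ ≤ (K * exp α * K * δ ^ 3) * K ^ p := by gcongr
      _ = _ := by ring
  have h6 : 0 ≤ h ξ * U ξ ^ 2 / 2 := by
    have := (H.h_le hξB).1
    have : 0 < h ξ := by linarith
    positivity
  have h7 : 0 ≤ U1 ξ ^ 2 := sq_nonneg _
  linarith

lemma exists_halfProfile_zero_sub_le {p : ℝ} (hp : 1 < p) : ∃ K > 0, ∃ δ₀ > 0,
    ∀ (δ B : ℝ) (h h1 U U1 : ℝ → ℝ), HalfProfile p δ B h h1 U U1 → δ ≤ δ₀ →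
      Qc p 1 0 ≤ U 0 ∧ U 0 - Qc p 1 0 ≤ K * δ := by
  obtain ⟨K, hK, α, hα, δ₀, hδ₀, hδ₁, hdec⟩ := exists_halfProfile_decay hp
  obtain ⟨K', hK', δ₀', hδ₀', hen⟩ := exists_halfProfile_energy_le hp
  obtain ⟨a, ha⟩ : ∃ a, a = Qc p 1 0 := ⟨_, rfl⟩
  have ha0 : 0 < a := by rw [ha]; exact Qc_one_pos hp 0
  have hap : a ^ (p - 1) = (p + 1) / 2 := by rw [ha]; exact Qc_one_zero_rpow hp
  have hc : 0 < a * ((p - 1) / 2) := mul_pos ha0 (by linarith)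
  refine ⟨(K' + K ^ 2 / (4 * α)) / (a * ((p - 1) / 2)), by positivity, min δ₀ δ₀',
    by positivity, fun δ B h h1 U U1 H hδ => ?_⟩
  obtain ⟨hB, -, hU⟩ := hdec δ B h h1 U U1 H (hδ.trans (min_le_left _ _))
  obtain ⟨ξ, hξ, hEξ⟩ := hen δ B h h1 U U1 H (hδ.trans (min_le_right _ _))
  have hδ0 := H.delta_pos
  have h0 : (0 : ℝ) ∈ Set.Icc 0 B := ⟨le_rfl, by linarith⟩
  have hU0 := H.pos 0 h0
  have hE0 := H.energy_nonneg 0 h0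
  have hmono := le_of_hasDerivAt_nonneg (a := 0) (b := ξ)
    (f := fun x => U1 x ^ 2 / 2 - h x * U x ^ 2 / 2 + U x ^ (p + 1) / (p + 1)
      - δ * K ^ 2 / (4 * α) * exp (-(2 * α) * x))
    (f' := fun x => -(h1 x * U x ^ 2 / 2)
      - δ * K ^ 2 / (4 * α) * (exp (-(2 * α) * x) * (-(2 * α) * 1))) (by linarith [hξ.1])
    (fun x hx => by
      have hxB : x ∈ Set.Icc 0 B := ⟨hx.1, hx.2.trans hξ.2⟩
      exact (hasDerivAt_energy hp (H.hasDerivAt_U x hxB) (H.hasDerivAt_U1 x hxB)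
        (H.hasDerivAt_h x hxB)).sub ((((hasDerivAt_id x).const_mul (-(2 * α))).exp).const_mul _))
    (fun x hx => by
      have hxB : x ∈ Set.Icc 0 B := ⟨hx.1, hx.2.trans hξ.2⟩
      have h2 : U x ^ 2 ≤ K ^ 2 * exp (-(2 * α) * x) := by
        have := pow_le_pow_left₀ (H.pos x hxB).le (hU x hxB) 2
        rw [mul_pow, ← exp_nat_mul] at this
        have e : ((2 : ℕ) : ℝ) * -(α * x) = -(2 * α) * x := by push_cast; ring
        rwa [e] at this
      have h3 : h1 x * U x ^ 2 ≤ δ * (K ^ 2 * exp (-(2 * α) * x)) := by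
        have h4 := (abs_le.1 (H.abs_h1_le x hxB)).2
        calc _ ≤ δ * U x ^ 2 := mul_le_mul_of_nonneg_right h4 (sq_nonneg _)
          _ ≤ _ := by gcongr
      have e : δ * K ^ 2 / (4 * α) * (exp (-(2 * α) * x) * (-(2 * α) * 1))
        = -(δ * (K ^ 2 * exp (-(2 * α) * x)) / 2) := by field_simp; ring
      rw [e]; linarith)
  have hE : U 0 ^ (p + 1) / (p + 1) - U 0 ^ 2 / 2 ≤ (K' + K ^ 2 / (4 * α)) * δ := by
    rw [H.h_zero, H.U1_zero] at hmono
    have h5 : 0 ≤ δ * K ^ 2 / (4 * α) * exp (-(2 * α) * ξ) := by positivity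
    have h6 : δ ^ 3 ≤ δ := by
      have : δ ≤ 1 := by linarith [hδ.trans (min_le_left _ _)]
      have := pow_le_pow_of_le_one hδ0.le this (show 1 ≤ 3 by norm_num)
      simpa using this
    have h7 : K' * δ ^ 3 ≤ K' * δ := by gcongr
    simp only [mul_zero, exp_zero, mul_one] at hmono
    have e : (K' + K ^ 2 / (4 * α)) * δ = K' * δ + δ * K ^ 2 / (4 * α) := by ring
    rw [e]; linarith
  have haU : a ≤ U 0 := by
    rw [H.h_zero, H.U1_zero, rpow_add_one_eq hU0] at hE0
    have h8 : (p + 1) / 2 ≤ U 0 ^ (p - 1) := by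
      by_contra hlt
      rw [not_le] at hlt
      have : U 0 ^ 2 * U 0 ^ (p - 1) / (p + 1) < U 0 ^ 2 / 2 := by
        rw [div_lt_div_iff₀ (by linarith) two_pos]
        have : 0 < U 0 ^ 2 := by positivity
        nlinarith
      linarith
    rw [← hap] at h8
    exact (rpow_le_rpow_iff ha0.le hU0.le (by linarith)).1 h8
  rw [← ha]
  refine ⟨haU, ?_⟩
  have hG := le_of_hasDerivAt_nonneg (a := a) (b := U 0)
    (f := fun t => t ^ (p + 1) / (p + 1) - t ^ 2 / 2 - a * ((p - 1) / 2) * t)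
    (f' := fun t => 1 * (p + 1) * t ^ (p + 1 - 1) / (p + 1) - (2 : ℕ) * t ^ (2 - 1) * 1 / 2
      - a * ((p - 1) / 2) * 1) haU
    (fun t ht => ((((hasDerivAt_id t).rpow_const (Or.inr (by linarith))).div_const _).sub
      (((hasDerivAt_id t).pow 2).div_const 2)).sub ((hasDerivAt_id t).const_mul _))
    (fun t ht => by
      have ht0 : 0 < t := ha0.trans_le ht.1
      have h9 : (p + 1) / 2 ≤ t ^ (p - 1) := by
        rw [← hap]; exact rpow_le_rpow ha0.le ht.1 (by linarith)
      have e : 1 * (p + 1) * t ^ (p + 1 - 1) / (p + 1) = t * t ^ (p - 1) := by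
        have : p + 1 ≠ 0 := by linarith
        rw [add_sub_cancel_right, rpow_eq_mul_rpow_sub_one ht0]; field_simp
      rw [e]
      simp only [Nat.add_one_sub_one, pow_one, Nat.cast_ofNat]
      have h10 := ht.1
      nlinarith)
  have hGa : a ^ (p + 1) / (p + 1) - a ^ 2 / 2 = 0 := by
    rw [rpow_add_one_eq ha0, hap]
    have : p + 1 ≠ 0 := by linarith
    field_simp; ring
  rw [div_mul_eq_mul_div, le_div_iff₀ hc]
  linarith

lemma quadratic_growth_bound {d d1 f g F L : ℝ} (hL : 0 ≤ L) (hg : |g| ≤ L * |d|)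
    (hf : |f| ≤ F) :
    2 * d * d1 + 2 * d1 * (f + d - g) ≤ (3 + L) * (d ^ 2 + d1 ^ 2 + F ^ 2) := by
  have h3 : 2 * (d1 * f) ≤ d1 ^ 2 + F ^ 2 := by
    have := sq_le_sq' (by linarith [(abs_le.1 hf).1]) (abs_le.1 hf).2
    nlinarith [sq_nonneg (d1 - f)]
  have h5 : d1 * (-g) ≤ |d1| * (L * |d|) := by
    refine (le_abs_self _).trans ?_
    rw [abs_mul, abs_neg]
    gcongr
  have h6 : 2 * (|d1| * |d|) ≤ d1 ^ 2 + d ^ 2 := by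
    rw [← sq_abs d1, ← sq_abs d]; nlinarith [sq_nonneg (|d1| - |d|)]
  have h6' := mul_le_mul_of_nonneg_left h6 hL
  have h7 : 4 * (d1 * d) ≤ 2 * (d1 ^ 2 + d ^ 2) := by nlinarith [sq_nonneg (d1 - d)]
  have h8 : 0 ≤ L * F ^ 2 := by positivity
  have h9 : 0 ≤ F ^ 2 := sq_nonneg F
  have h10 : 0 ≤ d ^ 2 := sq_nonneg d
  linarith

lemma exists_halfProfile_sub_le_of_le {p : ℝ} (hp : 1 < p) {Y : ℝ} (hY : 0 < Y) :
    ∃ K > 0, ∃ δ₀ > 0,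
    ∀ (δ B : ℝ) (h h1 U U1 : ℝ → ℝ), HalfProfile p δ B h h1 U U1 → δ ≤ δ₀ →
      ∀ x ∈ Set.Icc 0 B, x ≤ Y → |U x - Qc p 1 x| ≤ K * δ := by
  obtain ⟨K, hK, δ₀, hδ₀, hzero⟩ := exists_halfProfile_zero_sub_le hp
  obtain ⟨M, hM, hUM⟩ := exists_halfProfile_zero_le hp
  obtain ⟨K₂, hK₂, α, hα, δ₁, hδ₁, hδ₁', hdec⟩ := exists_halfProfile_decay hp
  obtain ⟨Lp, hLp⟩ : ∃ Lp, Lp = p * M ^ (p - 1) := ⟨_, rfl⟩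
  have hLp0 : 0 < Lp := by rw [hLp]; positivity
  obtain ⟨C, hC⟩ : ∃ C, C = 3 + Lp := ⟨_, rfl⟩
  obtain ⟨D, hD⟩ : ∃ D, D = (K ^ 2 + (Y * M) ^ 2) * exp (C * Y) := ⟨_, rfl⟩
  have hD0 : 0 < D := by rw [hD]; positivity
  refine ⟨√D, sqrt_pos.2 hD0, min δ₀ δ₁, by positivity, fun δ B h h1 U U1 H hδ x hx hxY => ?_⟩
  obtain ⟨ha, hUa⟩ := hzero δ B h h1 U U1 H (hδ.trans (min_le_left _ _))
  obtain ⟨hB, -, -⟩ := hdec δ B h h1 U U1 H (hδ.trans (min_le_right _ _))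
  have hδ0 := H.delta_pos
  have hU0 := hUM δ B h h1 U U1 H hB
  obtain ⟨Q1, hQ1⟩ : ∃ Q1 : ℝ → ℝ, Q1 = fun x => -(Qc p 1 x * tanh ((p - 1) / 2 * x)) := ⟨_, rfl⟩
  have hdQ : ∀ x, HasDerivAt (Qc p 1) (Q1 x) x := fun x => by
    rw [hQ1]; exact hasDerivAt_Qc_one hp x
  have hdQ1 : ∀ x, HasDerivAt Q1 (Qc p 1 x - Qc p 1 x ^ p) x := fun x => by
    rw [hQ1]; exact hasDerivAt_deriv_Qc_one hp x
  have hmono := ge_of_hasDerivAt_nonpos (a := 0) (b := x)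
    (f := fun z => ((U z - Qc p 1 z) ^ 2 + (U1 z - Q1 z) ^ 2 + (δ * (Y * M)) ^ 2)
      * exp (-C * z))
    (f' := fun z => (((2 : ℕ) * (U z - Qc p 1 z) ^ (2 - 1) * (U1 z - Q1 z)
      + (2 : ℕ) * (U1 z - Q1 z) ^ (2 - 1)
        * ((h z * U z - U z ^ p) - (Qc p 1 z - Qc p 1 z ^ p))) * exp (-C * z)
      + ((U z - Qc p 1 z) ^ 2 + (U1 z - Q1 z) ^ 2 + (δ * (Y * M)) ^ 2)
        * (exp (-C * z) * (-C * 1)))) hx.1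
    (fun z hz => by
      have hzB : z ∈ Set.Icc 0 B := ⟨hz.1, hz.2.trans hx.2⟩
      exact (((((H.hasDerivAt_U z hzB).sub (hdQ z)).pow 2).add
        (((H.hasDerivAt_U1 z hzB).sub (hdQ1 z)).pow 2)).add_const _).mul
        (((hasDerivAt_id z).const_mul (-C)).exp))
    (fun z hz => by
      have hzB : z ∈ Set.Icc 0 B := ⟨hz.1, hz.2.trans hx.2⟩
      have hz0 := H.pos z hzB
      have hzM : U z ≤ M := (H.antitone le_rfl hz.1 hzB.2).trans hU0
      have hQM : Qc p 1 z ≤ M :=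
        (Qc_one_le_of_abs_le hp (by simp : |(0 : ℝ)| ≤ |z|)).trans (ha.trans hU0)
      have h1 := abs_rpow_sub_rpow_le hp.le ⟨hz0.le, hzM⟩ ⟨(Qc_one_pos hp z).le, hQM⟩
      rw [← hLp] at h1
      have h2 : |(h z - 1) * U z| ≤ δ * (Y * M) := by
        rw [abs_mul, abs_of_pos hz0, ← mul_assoc]
        have := H.abs_h_sub_one_le hzB
        have hzY : z ≤ Y := hz.2.trans hxY
        gcongr
        exact this.trans (by gcongr)
      obtain ⟨d, hd⟩ : ∃ d, d = U z - Qc p 1 z := ⟨_, rfl⟩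
      obtain ⟨d1, hd1⟩ : ∃ d1, d1 = U1 z - Q1 z := ⟨_, rfl⟩
      obtain ⟨g, hg⟩ : ∃ g, g = U z ^ p - Qc p 1 z ^ p := ⟨_, rfl⟩
      obtain ⟨f, hf⟩ : ∃ f, f = (h z - 1) * U z := ⟨_, rfl⟩
      have e : h z * U z - U z ^ p - (Qc p 1 z - Qc p 1 z ^ p) = f + d - g := by
        rw [hf, hd, hg]; ring
      rw [e, ← hd, ← hd1]
      rw [← hd, ← hg] at h1
      rw [← hf] at h2
      obtain ⟨F, hF⟩ : ∃ F, F = δ * (Y * M) := ⟨_, rfl⟩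
      rw [← hF] at h2 ⊢
      have h8 := quadratic_growth_bound (d1 := d1) hLp0.le h1 h2
      rw [← hC] at h8
      simp only [Nat.add_one_sub_one, pow_one, Nat.cast_ofNat]
      have := mul_le_mul_of_nonneg_right h8 (exp_pos (-C * z)).le
      linarith)
  have hQ10 : Q1 0 = 0 := by rw [hQ1]; simp
  simp only [H.U1_zero, hQ10, mul_zero, exp_zero, mul_one, sub_zero] at hmono
  have h0 : (U 0 - Qc p 1 0) ^ 2 ≤ (K * δ) ^ 2 := pow_le_pow_left₀ (by linarith) hUa 2
  have h1 : (U x - Qc p 1 x) ^ 2 * exp (-C * x) ≤ (K ^ 2 + (Y * M) ^ 2) * δ ^ 2 := by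
    have h2 : (U x - Qc p 1 x) ^ 2 * exp (-C * x) ≤
        ((U x - Qc p 1 x) ^ 2 + (U1 x - Q1 x) ^ 2 + (δ * (Y * M)) ^ 2) * exp (-C * x) := by
      refine mul_le_mul_of_nonneg_right ?_ (exp_pos _).le
      have : 0 ≤ (U1 x - Q1 x) ^ 2 := sq_nonneg _
      have : 0 ≤ (δ * (Y * M)) ^ 2 := sq_nonneg _
      linarith
    nlinarith
  have h2 : (U x - Qc p 1 x) ^ 2 ≤ (√D * δ) ^ 2 := by
    rw [mul_pow, sq_sqrt hD0.le, hD]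
    rw [neg_mul, exp_neg, ← div_eq_mul_inv, div_le_iff₀ (exp_pos _)] at h1
    have h3 : exp (C * x) ≤ exp (C * Y) := exp_le_exp.2 (by
      have : 0 < C := by rw [hC]; positivity
      gcongr)
    refine h1.trans ?_
    have : 0 ≤ (K ^ 2 + (Y * M) ^ 2) * δ ^ 2 := by positivity
    nlinarith
  exact abs_le_of_sq_le_sq h2 (by positivity)

lemma tendsto_const_mul_exp_neg {α : ℝ} (hα : 0 < α) (K : ℝ) :
    Tendsto (fun x => K * exp (-(α * x))) atTop (nhds 0) := by
  have h := (tendsto_exp_neg_atTop_nhds_zero.comp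
    (tendsto_id.const_mul_atTop hα)).const_mul K
  simpa [Function.comp_def] using h

theorem exists_halfProfile_sub_le {p : ℝ} (hp : 1 < p) : ∃ K > 0, ∃ δ₀ > 0,
    ∀ (δ B : ℝ) (h h1 U U1 : ℝ → ℝ), HalfProfile p δ B h h1 U U1 → δ ≤ δ₀ →
      ∀ x ∈ Set.Icc 0 B, |U x - Qc p 1 x| ≤ K * δ := by
  have hp1 : 0 < p - 1 := by linarith
  obtain ⟨K, hK, α, hα, δ₀, hδ₀, hδ₁, hdec⟩ := exists_halfProfile_decay hp
  obtain ⟨KQ, hKQ, hQdec⟩ := exists_Qc_one_le_exp hp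
  obtain ⟨η, hη⟩ : ∃ η : ℝ, η = (1 / (2 * p)) ^ (1 / (p - 1)) := ⟨_, rfl⟩
  have hη0 : 0 < η := by rw [hη]; positivity
  have hηp : p * η ^ (p - 1) = 1 / 2 := by
    rw [hη, ← rpow_mul (by positivity), one_div_mul_cancel hp1.ne', rpow_one]; field_simp
  obtain ⟨Y, hYη, hY0⟩ : ∃ Y, (∀ x, Y ≤ x → K * exp (-(α * x)) ≤ η ∧ KQ * exp (-(1 * x)) ≤ η)
      ∧ 0 < Y := by
    obtain ⟨Y, hY⟩ := eventually_atTop.1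
      (((tendsto_const_mul_exp_neg hα K).eventually (ge_mem_nhds hη0)).and
        ((tendsto_const_mul_exp_neg one_pos KQ).eventually (ge_mem_nhds hη0)))
    exact ⟨max Y 1, fun x hx => hY x ((le_max_left _ _).trans hx),
      lt_of_lt_of_le one_pos (le_max_right _ _)⟩
  obtain ⟨K₁, hK₁, δ₁, hδ₁', hloc⟩ := exists_halfProfile_sub_le_of_le hp hY0
  obtain ⟨C₁, hC₁, hxexp⟩ := exists_pow_mul_exp_neg_le 1 hα
  obtain ⟨C₂, hC₂, hxexp2⟩ := exists_pow_mul_exp_neg_le 1 one_pos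
  obtain ⟨θ, hθ⟩ : ∃ θ, θ = (p - 1) / (8 * (p + 1)) := ⟨_, rfl⟩
  have hθ0 : 0 < θ := by rw [hθ]; positivity
  refine ⟨K₁ + 2 * K * C₁ + K * K + KQ * C₂ / θ, by positivity, min δ₀ δ₁, by positivity,
    fun δ B h h1 U U1 H hδ => ?_⟩
  obtain ⟨hB, hB3, hU⟩ := hdec δ B h h1 U U1 H (hδ.trans (min_le_left _ _))
  have hloc' := hloc δ B h h1 U U1 H (hδ.trans (min_le_right _ _))
  have hδ0 := H.delta_pos
  obtain ⟨D, hD⟩ : ∃ D, D = (K₁ + 2 * K * C₁ + K * K + KQ * C₂ / θ) * δ := ⟨_, rfl⟩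
  rw [← hD]
  have hDs : D = K₁ * δ + 2 * K * C₁ * δ + K * K * δ + KQ * C₂ / θ * δ := by rw [hD]; ring
  have t1 : 0 < K₁ * δ := by positivity
  have t2 : 0 < 2 * K * C₁ * δ := by positivity
  have t3 : 0 < K * K * δ := by positivity
  have t4 : 0 < KQ * C₂ / θ * δ := by positivity
  intro x hx
  rcases le_total x Y with hxY | hxY
  · exact (hloc' x hx hxY).trans (by linarith)
  have hYB : Y ≤ B := hxY.trans hx.2
  have hYI : Y ∈ Set.Icc 0 B := ⟨hY0.le, hYB⟩
  have hBI : B ∈ Set.Icc 0 B := ⟨by linarith, le_rfl⟩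
  have hY := (hloc' Y hYI le_rfl).trans (show K₁ * δ ≤ D by linarith)
  have hBU : U B ≤ K * K * δ := by
    refine (hU B hBI).trans ?_
    have h6 : δ ^ 3 ≤ δ := by
      have := pow_le_pow_of_le_one hδ0.le ((hδ.trans (min_le_left _ _)).trans hδ₁)
        (show 1 ≤ 3 by norm_num)
      simpa using this
    calc K * exp (-(α * B)) ≤ K * (K * δ) := by gcongr; exact hB3.trans (by gcongr)
      _ = _ := by ring
  have hBQ : Qc p 1 B ≤ KQ * C₂ / θ * δ := by
    have hB0 : 0 < B := by linarith
    have h1 := hQdec B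
    rw [abs_of_pos hB0] at h1
    have h2 := hxexp2 B hB0.le
    rw [pow_one, one_mul] at h2
    have h3 : θ = δ * B := by rw [H.delta_mul, hθ]
    have e : KQ * C₂ / θ * δ = KQ * (C₂ / B) := by rw [h3]; field_simp
    rw [e]
    refine h1.trans (mul_le_mul_of_nonneg_left ?_ hKQ.le)
    rw [le_div_iff₀ hB0]; linarith
  have hbdU : ∀ z ∈ Set.Icc Y B, U z ∈ Set.Icc 0 η := fun z hz => by
    have hzB : z ∈ Set.Icc 0 B := ⟨hY0.le.trans hz.1, hz.2⟩
    exact ⟨(H.pos z hzB).le, (hU z hzB).trans (hYη z hz.1).1⟩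
  have hbdQ : ∀ z ∈ Set.Icc Y B, Qc p 1 z ∈ Set.Icc 0 η := fun z hz => by
    have hz0 : 0 ≤ z := hY0.le.trans hz.1
    have h1 := hQdec z
    have h2 := (hYη z hz.1).2
    rw [abs_of_nonneg hz0] at h1
    rw [one_mul] at h2
    exact ⟨(Qc_one_pos hp z).le, h1.trans h2⟩
  have hrhs : ∀ z ∈ Set.Icc Y B, |U z ^ p - Qc p 1 z ^ p| ≤ 1 / 2 * |U z - Qc p 1 z| ∧
      |(h z - 1) * U z| ≤ K * C₁ * δ := fun z hz => by
    have hzB : z ∈ Set.Icc 0 B := ⟨hY0.le.trans hz.1, hz.2⟩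
    refine ⟨by rw [← hηp]; exact abs_rpow_sub_rpow_le hp.le (hbdU z hz) (hbdQ z hz), ?_⟩
    rw [abs_mul, abs_of_pos (H.pos z hzB)]
    have h2 := hxexp z hzB.1
    rw [pow_one] at h2
    calc |h z - 1| * U z ≤ (δ * z) * (K * exp (-(α * z))) :=
          mul_le_mul (H.abs_h_sub_one_le hzB) (hU z hzB) (H.pos z hzB).le
            (mul_nonneg hδ0.le hzB.1)
      _ = δ * K * (z * exp (-(α * z))) := by ring
      _ ≤ δ * K * C₁ := by gcongr
      _ = _ := by ring
  have hB0 := H.pos B hBI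
  have hQ0 := Qc_one_pos hp B
  have hdU := fun z (hz : z ∈ Set.Icc Y B) => H.hasDerivAt_U z ⟨hY0.le.trans hz.1, hz.2⟩
  have hdU1 := fun z (hz : z ∈ Set.Icc Y B) => H.hasDerivAt_U1 z ⟨hY0.le.trans hz.1, hz.2⟩
  refine abs_le.2 ⟨?_, ?_⟩
  · have := le_of_second_deriv_pos (a := Y) (b := B) (D := D)
      (f := fun z => Qc p 1 z - U z)
      (fun z hz => (hasDerivAt_Qc_one hp z).sub (hdU z hz))
      (fun z hz => (hasDerivAt_deriv_Qc_one hp z).sub (hdU1 z hz))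
      (by have := (abs_le.1 hY).1; linarith) (by linarith)
      (fun z hz hDz _ => by
        obtain ⟨h1, h2⟩ := hrhs z hz
        rw [abs_of_nonpos (by linarith : U z - Qc p 1 z ≤ 0)] at h1
        have h3 := (abs_le.1 h1).1
        have h4 := (abs_le.1 h2).2
        have e : (h z - 1) * U z = h z * U z - U z := by ring
        linarith) x ⟨hxY, hx.2⟩
    linarith
  · exact le_of_second_deriv_pos (a := Y) (b := B) (D := D)
      (f := fun z => U z - Qc p 1 z)
      (fun z hz => (hdU z hz).sub (hasDerivAt_Qc_one hp z))
      (fun z hz => (hdU1 z hz).sub (hasDerivAt_deriv_Qc_one hp z))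
      (by exact (abs_le.1 hY).2) (by linarith)
      (fun z hz hDz _ => by
        obtain ⟨h1, h2⟩ := hrhs z hz
        rw [abs_of_nonneg (by linarith : 0 ≤ U z - Qc p 1 z)] at h1
        have h3 := (abs_le.1 h1).2
        have h4 := (abs_le.1 h2).1
        have e : (h z - 1) * U z = h z * U z - U z := by ring
        linarith) x ⟨hxY, hx.2⟩

lemma exists_halfProfile_energy_right_le {p : ℝ} (hp : 1 < p) : ∃ K > 0, ∃ δ₀ > 0,
    ∀ (δ B : ℝ) (h h1 U U1 : ℝ → ℝ), HalfProfile p δ B h h1 U U1 → δ ≤ δ₀ →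
      U1 B ^ 2 / 2 - h B * U B ^ 2 / 2 + U B ^ (p + 1) / (p + 1) ≤ K * δ ^ 3 := by
  obtain ⟨K, hK, α, hα, δ₀, hδ₀, hδ₁, hdec⟩ := exists_halfProfile_decay hp
  obtain ⟨K', hK', δ₀', hδ₀', hen⟩ := exists_halfProfile_energy_le hp
  refine ⟨K' + (K * exp α * K) ^ 2, by positivity, min δ₀ δ₀', by positivity,
    fun δ B h h1 U U1 H hδ => ?_⟩
  obtain ⟨hB, hB3, hU⟩ := hdec δ B h h1 U U1 H (hδ.trans (min_le_left _ _))
  obtain ⟨ξ, hξ, hEξ⟩ := hen δ B h h1 U U1 H (hδ.trans (min_le_right _ _))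
  have hδ0 := H.delta_pos
  have hδle : δ ≤ 1 := (hδ.trans (min_le_left _ _)).trans hδ₁
  have hsub : ∀ x ∈ Set.Icc ξ B, x ∈ Set.Icc 0 B := fun x hx =>
    ⟨by linarith [hx.1, hξ.1], hx.2⟩
  have hδ3 : δ ^ 3 ≤ 1 := pow_le_one₀ hδ0.le hδle
  have hδ30 : 0 < δ ^ 3 := by positivity
  have hbd : ∀ x ∈ Set.Icc ξ B, -(h1 x * U x ^ 2 / 2) ≤ (K * exp α * K) ^ 2 * δ ^ 3 := by
    intro x hx
    have hxB := hsub x hx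
    have h2 : U x ≤ K * exp α * K * δ ^ 3 := by
      refine (hU x hxB).trans ?_
      have e : exp (-(α * x)) ≤ exp α * exp (-(α * B)) := by
        rw [← exp_add, exp_le_exp]; nlinarith [hx.1, hξ.1]
      calc K * exp (-(α * x)) ≤ K * (exp α * exp (-(α * B))) := by gcongr
        _ ≤ K * (exp α * (K * δ ^ 3)) := by gcongr
        _ = _ := by ring
    have h3 := pow_le_pow_left₀ (H.pos x hxB).le h2 2
    rw [mul_pow] at h3
    have h4 : -h1 x ≤ 1 := by linarith [(abs_le.1 (H.abs_h1_le x hxB)).1]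
    have h5 : (K * exp α * K) ^ 2 * (δ ^ 3) ^ 2 ≤ (K * exp α * K) ^ 2 * δ ^ 3 := by
      gcongr
      nlinarith
    have h6 : 0 ≤ U x ^ 2 := sq_nonneg _
    nlinarith
  have hmono := ge_of_hasDerivAt_nonpos (a := ξ) (b := B)
    (f := fun x => U1 x ^ 2 / 2 - h x * U x ^ 2 / 2 + U x ^ (p + 1) / (p + 1)
      - (K * exp α * K) ^ 2 * δ ^ 3 * x)
    (f' := fun x => -(h1 x * U x ^ 2 / 2) - (K * exp α * K) ^ 2 * δ ^ 3 * 1) hξ.2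
    (fun x hx => (hasDerivAt_energy hp (H.hasDerivAt_U x (hsub x hx))
      (H.hasDerivAt_U1 x (hsub x hx)) (H.hasDerivAt_h x (hsub x hx))).sub
      ((hasDerivAt_id x).const_mul _))
    (fun x hx => by have := hbd x hx; linarith)
  have h7 : (K * exp α * K) ^ 2 * δ ^ 3 * (B - ξ) ≤ (K * exp α * K) ^ 2 * δ ^ 3 := by
    have : 0 ≤ (K * exp α * K) ^ 2 * δ ^ 3 := by positivity
    nlinarith [hξ.1]
  linarith

/-! ### Profiles in the rescaled radial variable -/

/-- The rescaled radial variable. -/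
noncomputable def radialScale (p N x : ℝ) : ℝ := 1 + 4 / (p + 3) * x / N

/-- The potential in the rescaled radial variable. -/
noncomputable def radialPot (p N l x : ℝ) : ℝ :=
  l * radialScale p N x ^ ((p - 1) / 2) + (1 - l) * radialScale p N x ^ (-2 : ℝ)

/-- The derivative of the potential in the rescaled radial variable. -/
noncomputable def radialPotDeriv (p N l x : ℝ) : ℝ :=
  4 / (p + 3) / N * (l * ((p - 1) / 2) * radialScale p N x ^ ((p - 1) / 2 - 1)
    - 2 * (1 - l) * radialScale p N x ^ (-3 : ℝ))

/-- A positive solution of `U'' = h U - U ^ p` which is critical at the origin and decays at both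
ends, where `h` is the rescaled radial potential. -/
structure RadialProfile (p N l : ℝ) (U U1 : ℝ → ℝ) : Prop where
  one_lt : 1 < p
  N_pos : 0 < N
  l_mem : l ∈ Set.Ioo (0 : ℝ) 1
  hasDerivAt_U : ∀ x, 0 < radialScale p N x → HasDerivAt U (U1 x) x
  hasDerivAt_U1 : ∀ x, 0 < radialScale p N x →
    HasDerivAt U1 (radialPot p N l x * U x - U x ^ p) x
  pos : ∀ x, 0 < radialScale p N x → 0 < U x
  U1_zero : U1 0 = 0
  tendsto_left : Tendsto (fun x => radialPot p N l x * U x ^ 2)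
    (nhdsWithin (-(N * (p + 3) / 4)) (Set.Ioi (-(N * (p + 3) / 4)))) (nhds 0)
  tendsto_right : Tendsto (fun x => radialPot p N l x * U x ^ 2) atTop (nhds 0)

section scale

variable {p N l x y : ℝ}

lemma radialScale_zero : radialScale p N 0 = 1 := by simp [radialScale]

lemma hasDerivAt_radialScale : HasDerivAt (radialScale p N) (4 / (p + 3) / N) x := by
  have := ((((hasDerivAt_id x).const_mul (4 / (p + 3))).div_const N).const_add 1)
  rw [mul_one] at this
  exact this

lemma radialScale_mono (hp : 1 < p) (hN : 0 < N) (hxy : x ≤ y) :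
    radialScale p N x ≤ radialScale p N y := by
  have : 0 < 4 / (p + 3) := div_pos (by norm_num) (by linarith)
  unfold radialScale
  gcongr

lemma radialScale_pos_iff (hp : 1 < p) (hN : 0 < N) :
    0 < radialScale p N x ↔ -(N * (p + 3) / 4) < x := by
  have e : radialScale p N x = 4 / (p + 3) / N * (x - -(N * (p + 3) / 4)) := by
    unfold radialScale
    field_simp
    ring
  have : 0 < 4 / (p + 3) / N := div_pos (div_pos (by norm_num) (by linarith)) hN
  rw [e, mul_pos_iff_of_pos_left this, sub_pos]

lemma radialPot_pos (hl : l ∈ Set.Ioo (0 : ℝ) 1) (hx : 0 < radialScale p N x) :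
    0 < radialPot p N l x := by
  have h1 := hl.1
  have h2 : 0 < 1 - l := by linarith [hl.2]
  unfold radialPot
  positivity

lemma radialPot_zero : radialPot p N l 0 = 1 := by
  simp [radialPot, radialScale_zero]

lemma hasDerivAt_radialPot (hx : 0 < radialScale p N x) :
    HasDerivAt (radialPot p N l) (radialPotDeriv p N l x) x := by
  have h1 := (hasDerivAt_radialScale (p := p) (N := N) (x := x))
  refine (((h1.rpow_const (p := (p - 1) / 2) (Or.inl hx.ne')).const_mul l).add
    ((h1.rpow_const (p := (-2 : ℝ)) (Or.inl hx.ne')).const_mul (1 - l))).congr_deriv ?_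
  rw [radialPotDeriv, show (-2 : ℝ) - 1 = -3 by norm_num]
  ring

lemma radialPotDeriv_eq (hx : 0 < radialScale p N x) : radialPotDeriv p N l x =
    4 / (p + 3) / N * radialScale p N x ^ (-3 : ℝ) *
      (l * ((p - 1) / 2) * radialScale p N x ^ ((p - 1) / 2 + 2) - 2 * (1 - l)) := by
  have e : radialScale p N x ^ ((p - 1) / 2 - 1)
      = radialScale p N x ^ (-3 : ℝ) * radialScale p N x ^ ((p - 1) / 2 + 2) := by
    rw [← rpow_add hx]; ring_nf
  rw [radialPotDeriv, e]
  ring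

end scale

namespace RadialProfile

variable {p N l : ℝ} {U U1 : ℝ → ℝ}

lemma energy_nonneg (H : RadialProfile p N l U U1) {x : ℝ} (hx : 0 < radialScale p N x) :
    0 ≤ U1 x ^ 2 / 2 - radialPot p N l x * U x ^ 2 / 2 + U x ^ (p + 1) / (p + 1) := by
  have hp := H.one_lt
  have hN := H.N_pos
  have hl := H.l_mem
  have hlow : ∀ y, 0 < radialScale p N y → -(radialPot p N l y * U y ^ 2) / 2 ≤
      U1 y ^ 2 / 2 - radialPot p N l y * U y ^ 2 / 2 + U y ^ (p + 1) / (p + 1) := by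
    intro y hy
    have h1 : 0 ≤ U y ^ (p + 1) / (p + 1) := by
      have := H.pos y hy
      have : 0 < p + 1 := by linarith
      positivity
    have h2 : 0 ≤ U1 y ^ 2 := sq_nonneg _
    linarith
  have hder : ∀ y, 0 < radialScale p N y → HasDerivAt
      (fun y => U1 y ^ 2 / 2 - radialPot p N l y * U y ^ 2 / 2 + U y ^ (p + 1) / (p + 1))
      (-(radialPotDeriv p N l y * U y ^ 2 / 2)) y := fun y hy =>
    hasDerivAt_energy hp (H.hasDerivAt_U y hy) (H.hasDerivAt_U1 y hy) (hasDerivAt_radialPot hy)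
  have hcoef : ∀ y, 0 < radialScale p N y →
      0 < 4 / (p + 3) / N * radialScale p N y ^ (-3 : ℝ) := fun y hy => by
    have : 0 < p + 3 := by linarith
    positivity
  have hlq : 0 ≤ l * ((p - 1) / 2) := mul_nonneg hl.1.le (by linarith)
  have hpow : ∀ y z, 0 < radialScale p N y → y ≤ z →
      radialScale p N y ^ ((p - 1) / 2 + 2) ≤ radialScale p N z ^ ((p - 1) / 2 + 2) :=
    fun y z hy hyz => rpow_le_rpow hy.le (radialScale_mono hp hN hyz) (by linarith)
  rcases le_total (l * ((p - 1) / 2) * radialScale p N x ^ ((p - 1) / 2 + 2) - 2 * (1 - l)) 0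
    with hs | hs
  · have htend := (H.tendsto_left.neg.div_const 2)
    rw [neg_zero, zero_div] at htend
    refine le_of_tendsto htend ?_
    have hmem : Set.Ioc (-(N * (p + 3) / 4)) x ∈
        nhdsWithin (-(N * (p + 3) / 4)) (Set.Ioi (-(N * (p + 3) / 4))) :=
      Ioc_mem_nhdsGT ((radialScale_pos_iff hp hN).1 hx)
    filter_upwards [hmem] with y hy
    have hy0 := (radialScale_pos_iff hp hN).2 hy.1
    refine (hlow y hy0).trans (le_of_hasDerivAt_nonneg hy.2
      (fun z hz => hder z (hy0.trans_le (radialScale_mono hp hN hz.1))) fun z hz => ?_)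
    have hz0 := hy0.trans_le (radialScale_mono hp hN hz.1)
    rw [radialPotDeriv_eq hz0]
    have h1 := mul_le_mul_of_nonneg_left (hpow z x hz0 hz.2) hlq
    have h2 := mul_nonneg_of_nonpos_of_nonpos
      (by linarith : l * ((p - 1) / 2) * radialScale p N z ^ ((p - 1) / 2 + 2) - 2 * (1 - l) ≤ 0)
      (by linarith [hcoef z hz0] : -(4 / (p + 3) / N * radialScale p N z ^ (-3 : ℝ)) ≤ 0)
    have h3 := mul_nonneg h2 (sq_nonneg (U z))
    linarith
  · have htend := (H.tendsto_right.neg.div_const 2)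
    rw [neg_zero, zero_div] at htend
    refine le_of_tendsto htend ?_
    filter_upwards [eventually_ge_atTop x] with y hy
    have hy0 := hx.trans_le (radialScale_mono hp hN hy)
    refine (hlow y hy0).trans (ge_of_hasDerivAt_nonpos hy
      (fun z hz => hder z (hx.trans_le (radialScale_mono hp hN hz.1))) fun z hz => ?_)
    have hz0 := hx.trans_le (radialScale_mono hp hN hz.1)
    rw [radialPotDeriv_eq hz0]
    have h1 := mul_le_mul_of_nonneg_left (hpow x z hx hz.1) hlq
    have h2 := mul_nonneg (hcoef z hz0).le
      (by linarith : 0 ≤ l * ((p - 1) / 2) * radialScale p N z ^ ((p - 1) / 2 + 2) - 2 * (1 - l))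
    have h3 := mul_nonneg h2 (sq_nonneg (U z))
    linarith

lemma second_deriv_neg (H : RadialProfile p N l U U1) {x : ℝ} (hx : 0 < radialScale p N x)
    (h0 : U1 x = 0) : radialPot p N l x * U x - U x ^ p < 0 := by
  have hp := H.one_lt
  have he := H.energy_nonneg hx
  have hU := H.pos x hx
  have hh := radialPot_pos H.l_mem hx
  rw [h0, rpow_add_one_eq hU] at he
  have h1 : radialPot p N l x * (p + 1) / 2 ≤ U x ^ (p - 1) := by
    by_contra hlt
    rw [not_le] at hlt
    have h2 : U x ^ (p - 1) / (p + 1) < radialPot p N l x / 2 := by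
      rw [div_lt_div_iff₀ (by linarith) two_pos]; linarith
    have h3 := mul_lt_mul_of_pos_left h2 (pow_pos hU 2)
    have e : U x ^ 2 * U x ^ (p - 1) / (p + 1) = U x ^ 2 * (U x ^ (p - 1) / (p + 1)) := by ring
    rw [e] at he
    linarith
  rw [rpow_eq_mul_rpow_sub_one hU]
  have h4 : radialPot p N l x < U x ^ (p - 1) := by nlinarith
  nlinarith

lemma scale_pos_of_nonneg (H : RadialProfile p N l U U1) {x : ℝ} (hx : 0 ≤ x) :
    0 < radialScale p N x := by
  have := radialScale_mono H.one_lt H.N_pos hx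
  rw [radialScale_zero] at this
  linarith

lemma U1_nonpos (H : RadialProfile p N l U U1) {x : ℝ} (hx : 0 ≤ x) : U1 x ≤ 0 := by
  have hs : ∀ y ∈ Set.Icc 0 x, 0 < radialScale p N y := fun y hy => H.scale_pos_of_nonneg hy.1
  exact image_le_of_deriv_right_lt_deriv_boundary (f := U1)
    (f' := fun y => radialPot p N l y * U y - U y ^ p) (a := 0) (b := x) (B := fun _ => 0)
    (B' := fun _ => 0)
    (fun y hy => (H.hasDerivAt_U1 y (hs y hy)).continuousAt.continuousWithinAt)
    (fun y hy => (H.hasDerivAt_U1 y (hs y ⟨hy.1, hy.2.le⟩)).hasDerivWithinAt)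
    H.U1_zero.le (fun y => hasDerivAt_const y 0)
    (fun y hy h0 => H.second_deriv_neg (hs y ⟨hy.1, hy.2.le⟩) h0) ⟨hx, le_rfl⟩

lemma hasDerivAt_comp_neg {f : ℝ → ℝ} {f' x : ℝ} (hf : HasDerivAt f f' (-x)) :
    HasDerivAt (fun y => f (-y)) (-f') x := by
  have := hf.comp x (hasDerivAt_neg x)
  simpa [Function.comp_def] using this

lemma U1_nonneg (H : RadialProfile p N l U U1) {x : ℝ} (hx : x ≤ 0)
    (hx0 : 0 < radialScale p N x) : 0 ≤ U1 x := by
  have hs : ∀ y ∈ Set.Icc 0 (-x), 0 < radialScale p N (-y) := fun y hy =>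
    hx0.trans_le (radialScale_mono H.one_lt H.N_pos (by linarith [hy.2]))
  have hd : ∀ y ∈ Set.Icc 0 (-x), HasDerivAt (fun y => -U1 (-y))
      (radialPot p N l (-y) * U (-y) - U (-y) ^ p) y := fun y hy => by
    exact (hasDerivAt_comp_neg (H.hasDerivAt_U1 (-y) (hs y hy))).neg.congr_deriv (neg_neg _)
  have := image_le_of_deriv_right_lt_deriv_boundary (f := fun y => -U1 (-y))
    (f' := fun y => radialPot p N l (-y) * U (-y) - U (-y) ^ p) (a := 0) (b := -x)
    (B := fun _ => 0) (B' := fun _ => 0)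
    (fun y hy => (hd y hy).continuousAt.continuousWithinAt)
    (fun y hy => (hd y ⟨hy.1, hy.2.le⟩).hasDerivWithinAt)
    (by simp [H.U1_zero]) (fun y => hasDerivAt_const y 0)
    (fun y hy h0 => H.second_deriv_neg (hs y ⟨hy.1, hy.2.le⟩) (neg_eq_zero.1 h0))
    (x := -x) ⟨by linarith, le_rfl⟩
  simpa using this

end RadialProfile

lemma radialScale_mem {p N σ x : ℝ} (hp : 1 < p) (hN : 0 < N) (hσ : σ ≤ 1 / 2)
    (hx : |x| ≤ σ * N) : radialScale p N x ∈ Set.Icc (1 / 2 : ℝ) (3 / 2) ∧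
      |radialScale p N x - 1| ≤ |x| / N := by
  have h1 : |radialScale p N x - 1| ≤ |x| / N := by
    have e : radialScale p N x - 1 = 4 / (p + 3) * (x / N) := by unfold radialScale; ring
    rw [e, abs_mul, abs_div x, abs_of_pos hN, abs_of_pos (div_pos (by norm_num) (by linarith))]
    have : 4 / (p + 3) ≤ 1 := by rw [div_le_one (by linarith)]; linarith
    exact mul_le_of_le_one_left (by positivity) this
  have h2 : |x| / N ≤ σ := by rwa [div_le_iff₀ hN]
  have h3 := abs_le.1 (h1.trans h2)
  exact ⟨⟨by linarith [h3.1], by linarith [h3.2]⟩, h1⟩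

/-- Size and first order expansion of the derivative of the potential. -/
lemma exists_radialPotDeriv_bound {p : ℝ} (hp : 1 < p) : ∃ D ≥ 1,
    ∀ N l x : ℝ, 0 < N → l ∈ Set.Ioo (0 : ℝ) 1 → |x| ≤ 1 / 2 * N →
      |radialPotDeriv p N l x| ≤ D / N ∧
      ∃ F, |F| ≤ D ∧ (∀ y, |y| ≤ 1 / 2 * N → |radialPotDeriv p N l y
        - 4 / (p + 3) / N * ((p + 3) / 2 * (l - 4 / (p + 3)) + F * y / N)|
        ≤ D * y ^ 2 / N ^ 3) := by
  obtain ⟨C₁, hC₁, h₁⟩ := exists_rpow_taylor ((p - 1) / 2 - 1)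
  obtain ⟨C₂, hC₂, h₂⟩ := exists_rpow_taylor (-3)
  obtain ⟨q, hq⟩ : ∃ q, q = (p - 1) / 2 := ⟨_, rfl⟩
  have hq0 : 0 < q := by rw [hq]; linarith
  rw [← hq] at h₁
  obtain ⟨g, hg⟩ : ∃ g, g = 4 / (p + 3) := ⟨_, rfl⟩
  have hg0 : 0 < g := by rw [hg]; exact div_pos (by norm_num) (by linarith)
  have hg1 : g ≤ 1 := by rw [hg, div_le_one (by linarith)]; linarith
  refine ⟨1 + q * C₁ + 2 * C₂ + (q * |q - 1| + 6), by
    have : 0 < q * C₁ := by positivity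
    have : 0 ≤ q * |q - 1| := by positivity
    linarith, fun N l x hN hl hx => ⟨?_, (l * q * (q - 1) + 6 * (1 - l)) * g, ?_, fun y hy => ?_⟩⟩
  · obtain ⟨hX, -⟩ := radialScale_mem hp hN le_rfl hx
    have a1 := (h₁ _ hX).1
    have a2 := (h₂ _ hX).1
    have hX0 : 0 < radialScale p N x := by linarith [hX.1]
    rw [radialPotDeriv, ← hq, ← hg, abs_mul, abs_of_pos (by positivity : 0 < g / N), div_mul_eq_mul_div]
    refine div_le_div_of_nonneg_right ?_ hN.le
    have b1 : 0 < radialScale p N x ^ (q - 1) := by positivity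
    have b2 : 0 < radialScale p N x ^ (-3 : ℝ) := by positivity
    have c1 : |l * q * radialScale p N x ^ (q - 1) - 2 * (1 - l) * radialScale p N x ^ (-3 : ℝ)|
        ≤ q * C₁ + 2 * C₂ := by
      have d1 : l * q * radialScale p N x ^ (q - 1) ≤ 1 * q * C₁ := by
        gcongr
        exact hl.2.le
      have d2 : 2 * (1 - l) * radialScale p N x ^ (-3 : ℝ) ≤ 2 * 1 * C₂ := by
        gcongr
        linarith [hl.1]
      have d3 : 0 ≤ l * q * radialScale p N x ^ (q - 1) :=
        mul_nonneg (mul_nonneg hl.1.le hq0.le) b1.le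
      have d4 : 0 ≤ 2 * (1 - l) * radialScale p N x ^ (-3 : ℝ) :=
        mul_nonneg (mul_nonneg two_pos.le (by linarith [hl.2])) b2.le
      rw [abs_le]; constructor <;> linarith
    have c2 : 0 ≤ q * |q - 1| := by positivity
    calc _ ≤ 1 * (q * C₁ + 2 * C₂) := by gcongr
      _ ≤ _ := by linarith
  · have c1 : |l * q * (q - 1) + 6 * (1 - l)| ≤ q * |q - 1| + 6 := by
      refine (abs_add_le _ _).trans ?_
      rw [abs_mul, abs_mul, abs_of_pos hl.1, abs_of_pos hq0,
        abs_of_pos (by linarith [hl.2] : 0 < 6 * (1 - l))]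
      have : l * q * |q - 1| ≤ 1 * q * |q - 1| := by gcongr; exact hl.2.le
      linarith [hl.1]
    rw [abs_mul, abs_of_pos hg0]
    have : 0 < q * C₁ := by positivity
    calc _ ≤ (q * |q - 1| + 6) * 1 := by gcongr
      _ ≤ _ := by linarith
  · obtain ⟨hX, -⟩ := radialScale_mem hp hN le_rfl hy
    have a1 := (h₁ _ hX).2.2
    have a2 := (h₂ _ hX).2.2
    obtain ⟨X, hXd⟩ : ∃ X, X = radialScale p N y := ⟨_, rfl⟩
    have hX1 : X - 1 = g * y / N := by rw [hXd, hg]; unfold radialScale; ring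
    rw [← hXd] at a1 a2
    have e : radialPotDeriv p N l y - 4 / (p + 3) / N * ((p + 3) / 2 * (l - 4 / (p + 3))
        + (l * q * (q - 1) + 6 * (1 - l)) * g * y / N)
        = g / N * (l * q * (X ^ (q - 1) - 1 - (q - 1) * (X - 1))
          - 2 * (1 - l) * (X ^ (-3 : ℝ) - 1 - (-3) * (X - 1))) := by
      rw [hX1, radialPotDeriv, ← hXd, ← hq, ← hg]
      have e1 : (p + 3) / 2 * (l - g) = l * q - 2 * (1 - l) := by
        rw [hg, hq]
        have : p + 3 ≠ 0 := by linarith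
        field_simp
        ring
      rw [e1]
      ring
    rw [e, abs_mul, abs_of_pos (by positivity : 0 < g / N)]
    have c1 : |l * q * (X ^ (q - 1) - 1 - (q - 1) * (X - 1))
        - 2 * (1 - l) * (X ^ (-3 : ℝ) - 1 - (-3) * (X - 1))|
        ≤ (q * C₁ + 2 * C₂) * (X - 1) ^ 2 := by
      refine (abs_sub _ _).trans ?_
      rw [abs_mul, abs_mul (2 * (1 - l)), abs_of_pos (mul_pos hl.1 hq0),
        abs_of_pos (by linarith [hl.2] : 0 < 2 * (1 - l))]
      have d1 : l * q * |X ^ (q - 1) - 1 - (q - 1) * (X - 1)| ≤ 1 * q * (C₁ * (X - 1) ^ 2) := by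
        gcongr
        exact hl.2.le
      have d2 : 2 * (1 - l) * |X ^ (-3 : ℝ) - 1 - (-3) * (X - 1)|
          ≤ 2 * 1 * (C₂ * (X - 1) ^ 2) := by
        gcongr
        linarith [hl.1]
      linarith
    have c2 : (X - 1) ^ 2 ≤ y ^ 2 / N ^ 2 := by
      rw [hX1, div_pow, mul_pow]
      have : g ^ 2 ≤ 1 := pow_le_one₀ hg0.le hg1
      have : g ^ 2 * y ^ 2 ≤ 1 * y ^ 2 := by gcongr
      gcongr
      linarith
    have c3 : 0 ≤ q * |q - 1| := by positivity
    calc _ ≤ 1 / N * ((q * C₁ + 2 * C₂) * (y ^ 2 / N ^ 2)) := by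
          gcongr
          exact c1.trans (by gcongr)
      _ = (q * C₁ + 2 * C₂) * (y ^ 2 / N ^ 3) := by field_simp
      _ ≤ (1 + q * C₁ + 2 * C₂ + (q * |q - 1| + 6)) * (y ^ 2 / N ^ 3) := by
          exact mul_le_mul_of_nonneg_right (by linarith [mul_pos hq0 hC₁, c3]) (by positivity)
      _ = _ := by ring

lemma RadialProfile.halfProfile {p N l δ B : ℝ} {U U1 : ℝ → ℝ} (H : RadialProfile p N l U U1)
    (hδ : 0 < δ) (hδB : δ * B = (p - 1) / (8 * (p + 1)))
    (hder : ∀ x, |x| ≤ B → |radialPotDeriv p N l x| ≤ δ) :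
    HalfProfile p δ B (radialPot p N l) (radialPotDeriv p N l) U U1 := by
  have hs : ∀ x ∈ Set.Icc 0 B, 0 < radialScale p N x := fun x hx => H.scale_pos_of_nonneg hx.1
  exact
  { one_lt := H.one_lt
    delta_pos := hδ
    delta_mul := hδB
    hasDerivAt_U := fun x hx => H.hasDerivAt_U x (hs x hx)
    hasDerivAt_U1 := fun x hx => H.hasDerivAt_U1 x (hs x hx)
    hasDerivAt_h := fun x hx => hasDerivAt_radialPot (hs x hx)
    abs_h1_le := fun x hx => hder x (by rw [abs_of_nonneg hx.1]; exact hx.2)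
    h_zero := radialPot_zero
    pos := fun x hx => H.pos x (hs x hx)
    U1_zero := H.U1_zero
    U1_nonpos := fun x hx => H.U1_nonpos hx.1
    energy_nonneg := fun x hx => H.energy_nonneg (hs x hx) }

lemma RadialProfile.halfProfile_comp_neg {p N l δ B : ℝ} {U U1 : ℝ → ℝ}
    (H : RadialProfile p N l U U1) (hδ : 0 < δ) (hδB : δ * B = (p - 1) / (8 * (p + 1)))
    (hder : ∀ x, |x| ≤ B → |radialPotDeriv p N l x| ≤ δ)
    (hs : ∀ x, |x| ≤ B → 0 < radialScale p N x) :
    HalfProfile p δ B (fun x => radialPot p N l (-x)) (fun x => -radialPotDeriv p N l (-x))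
      (fun x => U (-x)) (fun x => -U1 (-x)) := by
  have hx' : ∀ x ∈ Set.Icc 0 B, |-x| ≤ B := fun x hx => by
    rw [abs_neg, abs_of_nonneg hx.1]; exact hx.2
  exact
  { one_lt := H.one_lt
    delta_pos := hδ
    delta_mul := hδB
    hasDerivAt_U := fun x hx =>
      RadialProfile.hasDerivAt_comp_neg (H.hasDerivAt_U (-x) (hs _ (hx' x hx)))
    hasDerivAt_U1 := fun x hx =>
      (RadialProfile.hasDerivAt_comp_neg (H.hasDerivAt_U1 (-x) (hs _ (hx' x hx)))).neg.congr_deriv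
        (neg_neg _)
    hasDerivAt_h := fun x hx =>
      RadialProfile.hasDerivAt_comp_neg (hasDerivAt_radialPot (hs _ (hx' x hx)))
    abs_h1_le := fun x hx => by rw [abs_neg]; exact hder _ (hx' x hx)
    h_zero := by rw [neg_zero]; exact radialPot_zero
    pos := fun x hx => H.pos _ (hs _ (hx' x hx))
    U1_zero := by rw [neg_zero, H.U1_zero, neg_zero]
    U1_nonpos := fun x hx => by
      have := H.U1_nonneg (by linarith [hx.1] : -x ≤ 0) (hs _ (hx' x hx))
      linarith
    energy_nonneg := fun x hx => by
      have := H.energy_nonneg (hs _ (hx' x hx))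
      rwa [neg_sq] }

/-- The energy of a radial profile. -/
noncomputable def radialEnergy (p N l : ℝ) (U U1 : ℝ → ℝ) (x : ℝ) : ℝ :=
  U1 x ^ 2 / 2 - radialPot p N l x * U x ^ 2 / 2 + U x ^ (p + 1) / (p + 1)

theorem exists_radialProfile_estimates {p : ℝ} (hp : 1 < p) :
    ∃ K > 0, ∃ α > 0, ∃ σ > 0, σ ≤ 1 / 8 ∧ ∃ N₀ ≥ 1, ∀ (N l : ℝ) (U U1 : ℝ → ℝ),
      RadialProfile p N l U U1 → N₀ ≤ N →
      2 ≤ σ * N ∧ exp (-(α * (σ * N))) ≤ K / N ^ 3 ∧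
      (∀ x, |x| ≤ σ * N → U x ≤ K * exp (-(α * |x|)) ∧ |U x - Qc p 1 x| ≤ K / N) ∧
      radialEnergy p N l U U1 (σ * N) ∈ Set.Icc 0 (K / N ^ 3) ∧
      radialEnergy p N l U U1 (-(σ * N)) ∈ Set.Icc 0 (K / N ^ 3) := by
  obtain ⟨K₁, hK₁, α, hα, δ₁, hδ₁, -, hdec⟩ := exists_halfProfile_decay hp
  obtain ⟨K₂, hK₂, δ₂, hδ₂, hclose⟩ := exists_halfProfile_sub_le hp
  obtain ⟨K₃, hK₃, δ₃, hδ₃, hen⟩ := exists_halfProfile_energy_right_le hp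
  obtain ⟨D, hD, hpot⟩ := exists_radialPotDeriv_bound hp
  have hD0 : 0 < D := by linarith
  obtain ⟨θ, hθ⟩ : ∃ θ, θ = (p - 1) / (8 * (p + 1)) := ⟨_, rfl⟩
  have hθ0 : 0 < θ := by rw [hθ]; exact div_pos (by linarith) (by linarith)
  have hθ1 : θ ≤ 1 / 8 := by rw [hθ, div_le_iff₀ (by linarith)]; linarith
  have hσ : θ / D ≤ 1 / 8 := (div_le_self hθ0.le hD).trans hθ1
  refine ⟨K₁ + K₁ * D ^ 3 + K₂ * D + K₃ * D ^ 3, by positivity, α, hα, θ / D, by positivity, hσ,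
    1 + D / δ₁ + D / δ₂ + D / δ₃, ?_, fun N l U U1 H hN => ?_⟩
  · have : 0 ≤ D / δ₁ + D / δ₂ + D / δ₃ := by positivity
    linarith
  have q1 : 0 < D / δ₁ := by positivity
  have q2 : 0 < D / δ₂ := by positivity
  have q3 : 0 < D / δ₃ := by positivity
  have hN0 : 0 < N := by linarith
  have hδ : 0 < D / N := by positivity
  have hsmall : ∀ d, 0 < d → D / d ≤ N → D / N ≤ d := fun d hd h => by
    rw [div_le_iff₀ hN0]; rwa [div_le_iff₀ hd, mul_comm] at h
  have hd1 := hsmall δ₁ hδ₁ (by linarith)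
  have hd2 := hsmall δ₂ hδ₂ (by linarith)
  have hd3 := hsmall δ₃ hδ₃ (by linarith)
  have hδB : D / N * (θ / D * N) = (p - 1) / (8 * (p + 1)) := by
    rw [← hθ]; field_simp
  have hhalf : ∀ x, |x| ≤ θ / D * N → |x| ≤ 1 / 2 * N := fun x hx =>
    hx.trans (mul_le_mul_of_nonneg_right (by linarith) hN0.le)
  have hder : ∀ x, |x| ≤ θ / D * N → |radialPotDeriv p N l x| ≤ D / N := fun x hx =>
    (hpot N l x hN0 H.l_mem (hhalf x hx)).1
  have hs : ∀ x, |x| ≤ θ / D * N → 0 < radialScale p N x := fun x hx => by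
    have := (radialScale_mem hp hN0 (by linarith) hx).1.1
    linarith
  have R := H.halfProfile hδ hδB hder
  have L := H.halfProfile_comp_neg hδ hδB hder hs
  obtain ⟨hB, hexp, hdR⟩ := hdec _ _ _ _ _ _ R hd1
  have hdL := (hdec _ _ _ _ _ _ L hd1).2.2
  have hcR := hclose _ _ _ _ _ _ R hd2
  have hcL := hclose _ _ _ _ _ _ L hd2
  have heR := hen _ _ _ _ _ _ R hd3
  have heL := hen _ _ _ _ _ _ L hd3
  have hB0 : 0 ≤ θ / D * N := by positivity
  have w1 : 0 < K₁ * D ^ 3 := by positivity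
  have w2 : 0 < K₂ * D := by positivity
  have w3 : 0 < K₃ * D ^ 3 := by positivity
  have hcube : ∀ k, 0 < k → k * D ^ 3 ≤ K₁ + K₁ * D ^ 3 + K₂ * D + K₃ * D ^ 3 →
      k * (D / N) ^ 3 ≤ (K₁ + K₁ * D ^ 3 + K₂ * D + K₃ * D ^ 3) / N ^ 3 := fun k _ h => by
    rw [div_pow, ← mul_div_assoc]
    gcongr
  refine ⟨hB, hexp.trans (hcube K₁ hK₁ (by linarith)), fun x hx => ?_, ⟨?_, ?_⟩, ⟨?_, ?_⟩⟩
  · have h1 : U x ≤ K₁ * exp (-(α * |x|)) ∧ |U x - Qc p 1 x| ≤ K₂ * (D / N) := by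
      rcases le_total 0 x with h0 | h0
      · rw [abs_of_nonneg h0] at hx ⊢
        exact ⟨hdR x ⟨h0, hx⟩, hcR x ⟨h0, hx⟩⟩
      · rw [abs_of_nonpos h0] at hx ⊢
        have a := hdL (-x) ⟨by linarith, hx⟩
        have b := hcL (-x) ⟨by linarith, hx⟩
        simp only [neg_neg] at a b
        rw [Qc_one_neg] at b
        exact ⟨a, b⟩
    refine ⟨h1.1.trans (mul_le_mul_of_nonneg_right (by linarith) (exp_pos _).le),
      h1.2.trans ?_⟩
    rw [← mul_div_assoc]
    gcongr
    linarith
  · exact H.energy_nonneg (hs _ (by rw [abs_of_nonneg hB0]))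
  · exact heR.trans (hcube K₃ hK₃ (by linarith))
  · exact H.energy_nonneg (hs _ (by rw [abs_neg, abs_of_nonneg hB0]))
  · rw [neg_sq] at heL
    exact heL.trans (hcube K₃ hK₃ (by linarith))

lemma mul_le_of_deriv_ge {Ψ Ψ1 G : ℝ → ℝ} {B a κ M β E : ℝ} (hB : 1 ≤ B) (hβ : 0 < β)
    (ha : 0 ≤ a) (hM : 0 ≤ M) (hd : ∀ x ∈ Set.Icc 0 B, HasDerivAt Ψ (Ψ1 x) x) (h0 : Ψ 0 = 0)
    (hG : ∀ x ∈ Set.Icc 0 B, 0 ≤ G x) (hκ : ∀ x ∈ Set.Icc (0 : ℝ) 1, κ ≤ G x)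
    (hb : ∀ x ∈ Set.Icc 0 B, a * G x - M * exp (-(β * x)) ≤ Ψ1 x) (hE : Ψ B ≤ E) :
    a * κ ≤ E + M / β := by
  have hd' : ∀ x ∈ Set.Icc 0 B, HasDerivAt (fun x => Ψ x - M / β * exp (-(β * x)))
      (Ψ1 x + M * exp (-(β * x))) x := fun x hx => by
    refine ((hd x hx).sub ((((hasDerivAt_id x).const_mul β).neg.exp).const_mul
      (M / β))).congr_deriv ?_
    simp only [id, mul_one, Pi.neg_apply]
    field_simp
    ring
  have s1 : ∀ x ∈ Set.Icc (0 : ℝ) 1, x ∈ Set.Icc 0 B := fun x hx => ⟨hx.1, hx.2.trans hB⟩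
  have s2 : ∀ x ∈ Set.Icc 1 B, x ∈ Set.Icc 0 B := fun x hx => ⟨by linarith [hx.1], hx.2⟩
  have h1 := le_of_hasDerivAt_nonneg zero_le_one
    (fun x hx => (hd' x (s1 x hx)).sub ((hasDerivAt_id x).const_mul (a * κ)))
    (fun x hx => by
      have := hb x (s1 x hx)
      have := mul_le_mul_of_nonneg_left (hκ x hx) ha
      linarith)
  have h2 := le_of_hasDerivAt_nonneg hB (fun x hx => hd' x (s2 x hx)) (fun x hx => by
      have := hb x (s2 x hx)
      have := mul_nonneg ha (hG x (s2 x hx))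
      linarith)
  simp only [Pi.sub_apply, id, h0, mul_zero, neg_zero, exp_zero, mul_one] at h1 h2
  have : 0 ≤ M / β * exp (-(β * B)) := by positivity
  linarith

lemma abs_mul_le_of_deriv_approx {Ψ Ψ1 G : ℝ → ℝ} {B a κ M β E : ℝ} (hB : 1 ≤ B) (hβ : 0 < β)
    (hM : 0 ≤ M) (hd : ∀ x ∈ Set.Icc 0 B, HasDerivAt Ψ (Ψ1 x) x) (h0 : Ψ 0 = 0)
    (hG : ∀ x ∈ Set.Icc 0 B, 0 ≤ G x) (hκ : ∀ x ∈ Set.Icc (0 : ℝ) 1, κ ≤ G x)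
    (hb : ∀ x ∈ Set.Icc 0 B, |Ψ1 x - a * G x| ≤ M * exp (-(β * x))) (hE : |Ψ B| ≤ E) :
    |a| * κ ≤ E + M / β := by
  rcases le_total 0 a with ha | ha
  · rw [abs_of_nonneg ha]
    exact mul_le_of_deriv_ge hB hβ ha hM hd h0 hG hκ
      (fun x hx => by linarith [(abs_le.1 (hb x hx)).1]) (abs_le.1 hE).2
  · rw [abs_of_nonpos ha]
    exact mul_le_of_deriv_ge (Ψ := fun x => -Ψ x) (Ψ1 := fun x => -Ψ1 x) hB hβ
      (neg_nonneg.2 ha) hM (fun x hx => (hd x hx).neg) (by rw [h0, neg_zero]) hG hκ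
      (fun x hx => by linarith [(abs_le.1 (hb x hx)).2]) (by linarith [(abs_le.1 hE).1])

theorem exists_radialProfile_l_sub_le {p : ℝ} (hp : 1 < p) : ∃ K > 0, ∃ N₀ ≥ 1,
    ∀ (N l : ℝ) (U U1 : ℝ → ℝ), RadialProfile p N l U U1 → N₀ ≤ N →
      |l - 4 / (p + 3)| ≤ K / N ^ 2 := by
  obtain ⟨K, hK, α, hα, σ, hσ, hσ8, N₀, hN₀, hest⟩ := exists_radialProfile_estimates hp
  obtain ⟨D, hD, hpot⟩ := exists_radialPotDeriv_bound hp
  have hβ : 0 < α / 2 := by positivity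
  obtain ⟨C₁, hC₁, he₁⟩ := exists_pow_mul_exp_neg_le 1 hβ
  obtain ⟨C₂, hC₂, he₂⟩ := exists_pow_mul_exp_neg_le 2 hβ
  have hQ1 := Qc_one_pos hp 1
  have hD0 : 0 < D := by linarith
  obtain ⟨g, hg⟩ : ∃ g, g = 4 / (p + 3) := ⟨_, rfl⟩
  have hg0 : 0 < g := by rw [hg]; exact div_pos (by norm_num) (by linarith)
  have hg1 : g ≤ 1 := by rw [hg, div_le_one (by linarith)]; linarith
  obtain ⟨M, hM⟩ : ∃ M, M = D * (2 * K ^ 2 * C₁) + D * K ^ 2 * C₂ := ⟨_, rfl⟩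
  have hM0 : 0 < M := by rw [hM]; positivity
  refine ⟨(K + M / (α / 2)) / (Qc p 1 1 ^ 2 / 4), by positivity,
    N₀ + 2 * K / Qc p 1 1, ?_, fun N l U U1 H hN => ?_⟩
  · have : 0 < 2 * K / Qc p 1 1 := by positivity
    linarith
  have hN1 : N₀ ≤ N := by
    have : 0 < 2 * K / Qc p 1 1 := by positivity
    linarith
  have hN2 : 2 * K / Qc p 1 1 ≤ N := by linarith
  have hN0 : 0 < N := by linarith
  obtain ⟨hB, -, hU, he1, he2⟩ := hest N l U U1 H hN1
  have hhalf : ∀ x, |x| ≤ σ * N → |x| ≤ 1 / 2 * N := fun x hx =>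
    hx.trans (mul_le_mul_of_nonneg_right (by linarith) hN0.le)
  obtain ⟨-, F, hF, hexp⟩ := hpot N l 0 hN0 H.l_mem (by rw [abs_zero]; positivity)
  rw [← hg] at hexp ⊢
  have hs : ∀ x, |x| ≤ σ * N → 0 < radialScale p N x := fun x hx => by
    have := (radialScale_mem hp hN0 (by linarith) hx).1.1
    linarith
  have habs : ∀ x ∈ Set.Icc 0 (σ * N), |x| ≤ σ * N ∧ |-x| ≤ σ * N := fun x hx => by
    rw [abs_neg, abs_of_nonneg hx.1]; exact ⟨hx.2, hx.2⟩
  have hde : ∀ x, |x| ≤ σ * N → HasDerivAt (radialEnergy p N l U U1)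
      (-(radialPotDeriv p N l x * U x ^ 2 / 2)) x := fun x hx =>
    hasDerivAt_energy hp (H.hasDerivAt_U x (hs x hx)) (H.hasDerivAt_U1 x (hs x hx))
      (hasDerivAt_radialPot (hs x hx))
  obtain ⟨F1, hF1⟩ : ∃ F1, F1 = (p + 3) / 2 * (l - g) := ⟨_, rfl⟩
  rw [← hF1] at hexp
  have key := abs_mul_le_of_deriv_approx
    (Ψ := fun x => radialEnergy p N l U U1 (-x) - radialEnergy p N l U U1 x)
    (Ψ1 := fun x => (radialPotDeriv p N l (-x) * U (-x) ^ 2 + radialPotDeriv p N l x * U x ^ 2) / 2)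
    (G := fun x => U x ^ 2 + U (-x) ^ 2) (B := σ * N) (a := g / (2 * N) * F1)
    (κ := Qc p 1 1 ^ 2 / 4) (M := M / N ^ 3) (β := α / 2) (E := K / N ^ 3)
    (by linarith) hβ (by positivity)
    (fun x hx => ((RadialProfile.hasDerivAt_comp_neg (hde (-x) (habs x hx).2)).sub
      (hde x (habs x hx).1)).congr_deriv (by ring)) (by simp)
    (fun x _ => by positivity)
    (fun x hx => by
      have hx1 : |x| ≤ σ * N := by rw [abs_of_nonneg hx.1]; linarith [hx.2]
      have h1 := (abs_le.1 (hU x hx1).2).1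
      have h2 : Qc p 1 1 ≤ Qc p 1 x := Qc_one_le_of_abs_le hp (by
        rw [abs_of_nonneg hx.1, abs_one]; exact hx.2)
      have h3 : K / N ≤ Qc p 1 1 / 2 := by
        rw [div_le_iff₀ hN0]
        rw [div_le_iff₀ hQ1] at hN2
        linarith
      have h4 : Qc p 1 1 / 2 ≤ U x := by linarith
      have h5 : (Qc p 1 1 / 2) ^ 2 ≤ U x ^ 2 := by gcongr
      have h6 : 0 ≤ U (-x) ^ 2 := sq_nonneg _
      linarith)
    (fun x hx => by
      have ⟨a1, a2⟩ := hU x (habs x hx).1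
      have ⟨b1, b2⟩ := hU (-x) (habs x hx).2
      rw [abs_neg, abs_of_nonneg hx.1] at b1
      rw [abs_of_nonneg hx.1] at a1
      rw [Qc_one_neg] at b2
      have pa := H.pos x (hs x (habs x hx).1)
      have pb := H.pos (-x) (hs (-x) (habs x hx).2)
      have r1 := hexp x (hhalf x (habs x hx).1)
      have r2 := hexp (-x) (hhalf (-x) (habs x hx).2)
      rw [neg_sq] at r2
      have hx0 := hx.1
      have eexp : exp (-(α * x)) = exp (-(α / 2 * x)) * exp (-(α / 2 * x)) := by
        rw [← exp_add]; ring_nf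
      have e1 := he₁ x hx0
      have e2 := he₂ x hx0
      rw [pow_one] at e1
      have ele : exp (-(α * x)) ≤ 1 := exp_le_one_iff.2 (by nlinarith)
      obtain ⟨R1, hR1⟩ : ∃ R, R = radialPotDeriv p N l x - g / N * (F1 + F * x / N) := ⟨_, rfl⟩
      obtain ⟨R2, hR2⟩ : ∃ R, R = radialPotDeriv p N l (-x) - g / N * (F1 + F * -x / N) :=
        ⟨_, rfl⟩
      rw [← hR1] at r1
      rw [← hR2] at r2
      have e : (radialPotDeriv p N l (-x) * U (-x) ^ 2 + radialPotDeriv p N l x * U x ^ 2) / 2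
          - g / (2 * N) * F1 * (U x ^ 2 + U (-x) ^ 2)
          = g / (2 * N ^ 2) * F * (x * ((U x - U (-x)) * (U x + U (-x))))
            + (R1 * U x ^ 2 + R2 * U (-x) ^ 2) / 2 := by
        rw [hR1, hR2]; field_simp; ring
      have t1 : |U x - U (-x)| ≤ 2 * (K / N) := by
        have := abs_sub_le (U x) (Qc p 1 x) (U (-x))
        rw [abs_sub_comm (Qc p 1 x)] at this
        linarith
      have t2 : |U x + U (-x)| ≤ 2 * (K * exp (-(α * x))) := by
        rw [abs_of_pos (by linarith)]; linarith
      have t3 : |x * ((U x - U (-x)) * (U x + U (-x)))|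
          ≤ 4 * K ^ 2 * C₁ / N * exp (-(α / 2 * x)) := by
        rw [abs_mul, abs_mul, abs_of_nonneg hx0]
        calc _ ≤ x * (2 * (K / N) * (2 * (K * exp (-(α * x))))) := by gcongr
          _ = 4 * K ^ 2 / N * (x * exp (-(α / 2 * x))) * exp (-(α / 2 * x)) := by
            rw [eexp]; ring
          _ ≤ 4 * K ^ 2 / N * C₁ * exp (-(α / 2 * x)) := by gcongr
          _ = _ := by ring
      have sq1 : ∀ u, 0 < u → u ≤ K * exp (-(α * x)) → u ^ 2 ≤ K ^ 2 * exp (-(α * x)) := by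
        intro u hu h
        calc u ^ 2 ≤ (K * exp (-(α * x))) ^ 2 := by gcongr
          _ = K ^ 2 * exp (-(α * x)) * exp (-(α * x)) := by ring
          _ ≤ K ^ 2 * exp (-(α * x)) * 1 := by gcongr
          _ = _ := mul_one _
      have t4 : ∀ R u, |R| ≤ D * x ^ 2 / N ^ 3 → 0 < u → u ≤ K * exp (-(α * x)) →
          |R * u ^ 2| ≤ D * K ^ 2 * C₂ / N ^ 3 * exp (-(α / 2 * x)) := by
        intro R u hR hu h
        rw [abs_mul, abs_of_nonneg (sq_nonneg u)]
        calc _ ≤ D * x ^ 2 / N ^ 3 * (K ^ 2 * exp (-(α * x))) :=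
              mul_le_mul hR (sq1 u hu h) (sq_nonneg _) (by positivity)
          _ = D * K ^ 2 / N ^ 3 * (x ^ 2 * exp (-(α / 2 * x))) * exp (-(α / 2 * x)) := by
            rw [eexp]; ring
          _ ≤ D * K ^ 2 / N ^ 3 * C₂ * exp (-(α / 2 * x)) := by gcongr
          _ = _ := by ring
      have u1 := t4 R1 (U x) r1 pa a1
      have u2 := t4 R2 (U (-x)) r2 pb b1
      have u3 : |g / (2 * N ^ 2) * F| ≤ 1 / (2 * N ^ 2) * D := by
        rw [abs_mul, abs_of_pos (by positivity)]
        gcongr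
      rw [e]
      refine (abs_add_le _ _).trans ?_
      have v1 : |g / (2 * N ^ 2) * F * (x * ((U x - U (-x)) * (U x + U (-x))))| ≤
          1 / (2 * N ^ 2) * D * (4 * K ^ 2 * C₁ / N * exp (-(α / 2 * x))) := by
        rw [abs_mul]
        gcongr
      have v2 : |(R1 * U x ^ 2 + R2 * U (-x) ^ 2) / 2| ≤
          D * K ^ 2 * C₂ / N ^ 3 * exp (-(α / 2 * x)) := by
        rw [abs_div, abs_two, div_le_iff₀ two_pos]
        exact (abs_add_le _ _).trans (by linarith)
      refine (add_le_add v1 v2).trans (le_of_eq ?_)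
      rw [hM]
      field_simp
      ring)
    (by rw [abs_le]; constructor <;> linarith [he1.1, he1.2, he2.1, he2.2])
  have e : |g / (2 * N) * F1| = |l - g| / N := by
    have : g / (2 * N) * F1 = (l - g) / N := by
      rw [hF1]
      nth_rewrite 1 [hg]
      have : p + 3 ≠ 0 := by linarith
      field_simp
      ring
    rw [this, abs_div, abs_of_pos hN0]
  rw [e] at key
  rw [div_div, le_div_iff₀ (by positivity)]
  have h2 : |l - g| / N * (Qc p 1 1 ^ 2 / 4) * N ^ 3
      ≤ (K / N ^ 3 + M / N ^ 3 / (α / 2)) * N ^ 3 :=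
    mul_le_mul_of_nonneg_right key (by positivity)
  have e3 : (K / N ^ 3 + M / N ^ 3 / (α / 2)) * N ^ 3 = K + M / (α / 2) := by field_simp
  have e4 : |l - g| / N * (Qc p 1 1 ^ 2 / 4) * N ^ 3 = |l - g| * (Qc p 1 1 ^ 2 / 4 * N ^ 2) := by
    field_simp
  rw [e3, e4] at h2
  exact h2

lemma RadialProfile.antitone {p N l x y : ℝ} {U U1 : ℝ → ℝ} (H : RadialProfile p N l U U1)
    (hx : 0 ≤ x) (hxy : x ≤ y) : U y ≤ U x :=
  ge_of_hasDerivAt_nonpos hxy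
    (fun z hz => H.hasDerivAt_U z (H.scale_pos_of_nonneg (hx.trans hz.1)))
    (fun _ hz => H.U1_nonpos (hx.trans hz.1))

lemma RadialProfile.monotone {p N l x y : ℝ} {U U1 : ℝ → ℝ} (H : RadialProfile p N l U U1)
    (hx : 0 < radialScale p N x) (hxy : x ≤ y) (hy : y ≤ 0) : U x ≤ U y := by
  have hs : ∀ z ∈ Set.Icc x y, 0 < radialScale p N z := fun z hz =>
    hx.trans_le (radialScale_mono H.one_lt H.N_pos hz.1)
  exact le_of_hasDerivAt_nonneg hxy (fun z hz => H.hasDerivAt_U z (hs z hz))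
    (fun z hz => H.U1_nonneg (hz.2.trans hy) (hs z hz))

/-- If the profile is already small at `y ≤ 0`, then `X ^ (-1/2) * U` is monotone to the left
of `y`. -/
lemma RadialProfile.weighted_monotone {p N l x y : ℝ} {U U1 : ℝ → ℝ}
    (H : RadialProfile p N l U U1) (hx : 0 < radialScale p N x) (hxy : x ≤ y) (hy : y ≤ 0)
    (hsmall : 2 * U y ^ (p - 1) + (4 / (p + 3)) ^ 2 / (4 * N ^ 2) ≤ 1 - l) :
    radialScale p N x ^ (-(1 / 2) : ℝ) * U x ≤ radialScale p N y ^ (-(1 / 2) : ℝ) * U y := by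
  have hp := H.one_lt
  have hN := H.N_pos
  have hs : ∀ z ∈ Set.Icc x y, 0 < radialScale p N z := fun z hz =>
    hx.trans_le (radialScale_mono hp hN hz.1)
  obtain ⟨g, hg⟩ : ∃ g, g = 4 / (p + 3) := ⟨_, rfl⟩
  have hg0 : 0 < g := by rw [hg]; exact div_pos (by norm_num) (by linarith)
  rw [← hg] at hsmall
  refine le_of_hasDerivAt_nonneg hxy (fun z hz => ((hasDerivAt_radialScale.rpow_const
    (p := (-(1 / 2) : ℝ)) (Or.inl (hs z hz).ne')).mul (H.hasDerivAt_U z (hs z hz)))) ?_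
  intro z hz
  have hX := hs z hz
  obtain ⟨X, hXd⟩ : ∃ X, X = radialScale p N z := ⟨_, rfl⟩
  have hX1 : X ≤ 1 := by
    have := radialScale_mono hp hN (hz.2.trans hy)
    rwa [radialScale_zero, ← hXd] at this
  have hU := H.pos z hX
  have hUy : U z ≤ U y := H.monotone hX hz.2 hy
  have hU1 := H.U1_nonneg (hz.2.trans hy) hX
  have he := H.energy_nonneg hX
  rw [rpow_add_one_eq hU] at he
  rw [← hXd] at hX
  have hpow : U z ^ (p - 1) ≤ U y ^ (p - 1) := rpow_le_rpow hU.le hUy (by linarith)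
  have hpow0 : 0 < U z ^ (p - 1) := rpow_pos_of_pos hU _
  have hhX : 1 - l ≤ radialPot p N l z * X ^ 2 := by
    have e : X ^ (-2 : ℝ) * X ^ 2 = 1 := by
      rw [← rpow_natCast, ← rpow_add hX]; norm_num
    have : 0 ≤ l * X ^ ((p - 1) / 2) * X ^ 2 :=
      mul_nonneg (mul_nonneg H.l_mem.1.le (rpow_pos_of_pos hX _).le) (by positivity)
    rw [radialPot, ← hXd, add_mul, mul_assoc (1 - l), e]
    linarith
  have h1 : (g / (2 * N) * U z) ^ 2 ≤ (U1 z * X) ^ 2 := by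
    have a1 : U z ^ (p - 1) / (p + 1) ≤ U y ^ (p - 1) := by
      rw [div_le_iff₀ (by linarith)]
      nlinarith
    have a2 : (radialPot p N l z - 2 * (U z ^ (p - 1) / (p + 1))) * U z ^ 2 ≤ U1 z ^ 2 := by
      have e : U z ^ 2 * U z ^ (p - 1) / (p + 1) = U z ^ 2 * (U z ^ (p - 1) / (p + 1)) := by ring
      rw [e] at he
      linarith
    have a3 : g ^ 2 / (4 * N ^ 2) ≤ (radialPot p N l z - 2 * (U z ^ (p - 1) / (p + 1))) * X ^ 2 := by
      have b1 : X ^ 2 ≤ 1 := pow_le_one₀ hX.le hX1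
      have b2 : 0 ≤ U z ^ (p - 1) / (p + 1) := div_nonneg hpow0.le (by linarith)
      have b3 : U z ^ (p - 1) / (p + 1) * X ^ 2 ≤ U z ^ (p - 1) / (p + 1) :=
        mul_le_of_le_one_right b2 b1
      linarith
    calc (g / (2 * N) * U z) ^ 2 = g ^ 2 / (4 * N ^ 2) * U z ^ 2 := by ring
      _ ≤ (radialPot p N l z - 2 * (U z ^ (p - 1) / (p + 1))) * X ^ 2 * U z ^ 2 := by gcongr
      _ = (radialPot p N l z - 2 * (U z ^ (p - 1) / (p + 1))) * U z ^ 2 * X ^ 2 := by ring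
      _ ≤ U1 z ^ 2 * X ^ 2 := by gcongr
      _ = _ := by ring
  have h2 : g / (2 * N) * U z ≤ U1 z * X := by
    refine le_of_sq_le_sq ?_ (mul_nonneg hU1 hX.le)
    exact h1
  have e2 : X ^ (-(1 / 2) - 1 : ℝ) = X ^ (-(1 / 2) : ℝ) / X := rpow_sub_one hX.ne' _
  rw [← hXd, ← hg, e2]
  have e3 : g / N * -(1 / 2) * (X ^ (-(1 / 2) : ℝ) / X) * U z + X ^ (-(1 / 2) : ℝ) * U1 z
      = X ^ (-(1 / 2) : ℝ) / X * (U1 z * X - g / (2 * N) * U z) := by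
    field_simp
    ring
  rw [e3]
  exact mul_nonneg (by positivity) (by linarith)

theorem exists_radialProfile_global {p : ℝ} (hp : 1 < p) :
    ∃ K > 0, ∃ α > 0, ∃ σ > 0, σ ≤ 1 / 8 ∧ ∃ N₀ ≥ 1, ∀ (N l : ℝ) (U U1 : ℝ → ℝ),
      RadialProfile p N l U U1 → N₀ ≤ N → |l - 4 / (p + 3)| ≤ K / N ^ 2 ∧
      (∀ x, |x| ≤ σ * N → U x ≤ K * exp (-(α * |x|)) ∧ |U x - Qc p 1 x| ≤ K / N) ∧
      (∀ x, 0 < radialScale p N x → σ * N ≤ |x| →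
        radialScale p N x ^ (-(1 / 2) : ℝ) * U x ≤ K / N) := by
  obtain ⟨K, hK, α, hα, σ, hσ, hσ8, N₀, hN₀, hest⟩ := exists_radialProfile_estimates hp
  obtain ⟨K', hK', N₁, hN₁, hl⟩ := exists_radialProfile_l_sub_le hp
  obtain ⟨g, hg⟩ : ∃ g, g = 4 / (p + 3) := ⟨_, rfl⟩
  have hg0 : 0 < g := by rw [hg]; exact div_pos (by norm_num) (by linarith)
  have hg1 : g < 1 := by rw [hg, div_lt_one (by linarith)]; linarith
  obtain ⟨κ, hκ⟩ : ∃ κ, κ = (1 - g) / 8 := ⟨_, rfl⟩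
  have hκ0 : 0 < κ := by rw [hκ]; linarith
  obtain ⟨η, hη⟩ : ∃ η, η = κ ^ (1 / (p - 1)) := ⟨_, rfl⟩
  have hη0 : 0 < η := by rw [hη]; positivity
  have hηp : η ^ (p - 1) = κ := by
    rw [hη, ← rpow_mul hκ0.le, one_div_mul_cancel (by linarith), rpow_one]
  have w1 : 0 < K ^ 2 / η := by positivity
  have w2 : 0 < K' / κ := by positivity
  have w3 : 0 < 1 / κ := by positivity
  refine ⟨K + K' + 2 * K ^ 2, by positivity, α, hα, σ, hσ, hσ8,
    N₀ + N₁ + K ^ 2 / η + K' / κ + 1 / κ, by linarith, fun N l U U1 H hN => ?_⟩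
  have hN1 : 1 ≤ N := by linarith
  have hN0 : 0 < N := by linarith
  have hNsq : N ≤ N ^ 2 := le_self_pow₀ hN1 two_ne_zero
  obtain ⟨hB, hexp, hU, -, -⟩ := hest N l U U1 H (by linarith)
  have hlN := hl N l U U1 H (by linarith)
  have hKpos : 0 < K ^ 2 := by positivity
  have hB0 : 0 ≤ σ * N := by positivity
  have hend : ∀ x, |x| = σ * N → U x ≤ K ^ 2 / N := fun x hx => by
    refine (hU x hx.le).1.trans ?_
    rw [hx]
    calc K * exp (-(α * (σ * N))) ≤ K * (K / N ^ 3) := by gcongr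
      _ ≤ K * (K / N ^ 1) := by gcongr; norm_num
      _ = _ := by rw [pow_one]; ring
  refine ⟨hlN.trans (by gcongr; linarith), fun x hx => ⟨(hU x hx).1.trans (by gcongr; linarith),
    (hU x hx).2.trans (by gcongr; linarith)⟩, fun x hx hBx => ?_⟩
  rcases le_total 0 x with h0 | h0
  · rw [abs_of_nonneg h0] at hBx
    have h1 := H.antitone hB0 hBx
    have h2 := hend (σ * N) (abs_of_nonneg hB0)
    have hX := radialScale_mono hp hN0 h0
    rw [radialScale_zero] at hX
    have h3 : radialScale p N x ^ (-(1 / 2) : ℝ) ≤ 1 :=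
      rpow_le_one_of_one_le_of_nonpos hX (by norm_num)
    calc _ ≤ 1 * U x := mul_le_mul_of_nonneg_right h3 (H.pos x hx).le
      _ ≤ K ^ 2 / N := by linarith
      _ ≤ _ := by gcongr; linarith
  · rw [abs_of_nonpos h0] at hBx
    have hBm := radialScale_mem hp hN0 (by linarith : σ ≤ 1 / 2)
      (by rw [abs_neg, abs_of_nonneg hB0] : |-(σ * N)| ≤ σ * N)
    have hX := hBm.1.1
    have h2 := hend (-(σ * N)) (by rw [abs_neg, abs_of_nonneg hB0])
    have hUp := H.pos (-(σ * N)) (by linarith)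
    have h3 := H.weighted_monotone hx (by linarith : x ≤ -(σ * N)) (by linarith) (by
      have a1 : U (-(σ * N)) ^ (p - 1) ≤ κ := by
        rw [← hηp]
        refine rpow_le_rpow hUp.le (h2.trans ?_) (by linarith)
        rw [div_le_iff₀ hN0, mul_comm, ← div_le_iff₀ hη0]
        linarith
      have a2 : (4 / (p + 3)) ^ 2 / (4 * N ^ 2) ≤ κ := by
        rw [← hg]
        have b1 : g ^ 2 ≤ 1 := pow_le_one₀ hg0.le hg1.le
        have b2 : 1 / κ ≤ N := by linarith
        rw [div_le_iff₀ hκ0] at b2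
        rw [div_le_iff₀ (by positivity)]
        have b3 : N * κ ≤ N ^ 2 * κ := mul_le_mul_of_nonneg_right hNsq hκ0.le
        linarith
      have a3 : l - g ≤ κ := by
        refine (le_abs_self _).trans ((hg ▸ hlN).trans ?_)
        have b2 : K' / κ ≤ N := by linarith
        rw [div_le_iff₀ hκ0] at b2
        rw [div_le_iff₀ (by positivity)]
        have b3 : N * κ ≤ N ^ 2 * κ := mul_le_mul_of_nonneg_right hNsq hκ0.le
        linarith
      have a4 : 1 - g = 8 * κ := by rw [hκ]; ring
      linarith)
    have h4 : radialScale p N (-(σ * N)) ^ (-(1 / 2) : ℝ) ≤ 2 := by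
      calc _ ≤ (1 / 2 : ℝ) ^ (-(1 / 2) : ℝ) :=
            rpow_le_rpow_of_nonpos (by norm_num) hX (by norm_num)
        _ ≤ (1 / 2 : ℝ) ^ (-1 : ℝ) :=
            rpow_le_rpow_of_exponent_ge (by norm_num) (by norm_num) (by norm_num)
        _ = 2 := by rw [rpow_neg_one]; norm_num
    calc _ ≤ _ := h3
      _ ≤ 2 * (K ^ 2 / N) := mul_le_mul h4 h2 hUp.le (by norm_num)
      _ = 2 * K ^ 2 / N := by ring
      _ ≤ _ := by gcongr; linarith

lemma abs_sqrt_sub_one_le {t : ℝ} (ht : 0 ≤ t) : |√t - 1| ≤ |t - 1| := by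
  have e : t - 1 = (√t - 1) * (√t + 1) := by
    have := Real.mul_self_sqrt ht
    linarith
  rw [e, abs_mul, abs_of_pos (by positivity : 0 < √t + 1)]
  exact le_mul_of_one_le_right (abs_nonneg _) (by linarith [Real.sqrt_nonneg t])

/-- Comparison of the exact scaling parameters of a radial profile with their limits. -/
lemma exists_scaling_bound {p ω K : ℝ} (hp : 1 < p) (hω : 0 < ω) (hK : 0 < K) :
    ∃ C > 0, ∃ N₁ ≥ 1, ∀ N l R m : ℝ, 0 < R → 0 ≤ m → N₁ ≤ N → l ∈ Set.Ioo (0 : ℝ) 1 →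
      ω * R ^ 2 = l * N ^ 2 → (1 - l) * N ^ 2 + (4 / (p + 3)) ^ 2 / 4 = m ^ 2 →
      |l - 4 / (p + 3)| ≤ K / N ^ 2 →
      |√(l / (4 / (p + 3))) - 1| ≤ C / N ∧ 1 / 2 ≤ √(l / (4 / (p + 3))) ∧
      |√((p + 3) * ω / 4) * R - √((p + 3) * ω / 4) * (2 * m / √((p - 1) * ω))| ≤ C / N ∧
      √((p + 3) * ω / 4) * R = N * √(l / (4 / (p + 3))) ∧
      |(ω / l) ^ (1 / (p - 1)) - ((p + 3) * ω / 4) ^ (1 / (p - 1))| ≤ C / N := by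
  obtain ⟨g, hg⟩ : ∃ g, g = 4 / (p + 3) := ⟨_, rfl⟩
  have hg0 : 0 < g := by rw [hg]; exact div_pos (by norm_num) (by linarith)
  have hg1 : g < 1 := by rw [hg, div_lt_one (by linarith)]; linarith
  obtain ⟨c, hc⟩ : ∃ c, c = (p + 3) * ω / 4 := ⟨_, rfl⟩
  have hcg : c = ω / g := by rw [hc, hg]; field_simp
  have hc0 : 0 < c := by rw [hcg]; positivity
  rw [← hg, ← hc]
  obtain ⟨C₁, hC₁, ht⟩ := exists_rpow_taylor (-(1 / (p - 1)))
  have h1g : 0 < 1 - g := by linarith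
  have w1 : 0 < K / g := by positivity
  have w2 : 0 < 2 * (K / (g * (1 - g)) + 1 / (1 - g)) := by positivity
  have w3 : 0 < c ^ (1 / (p - 1)) * (C₁ * (K / g)) := by positivity
  refine ⟨K / g + 2 * (K / (g * (1 - g)) + 1 / (1 - g)) + c ^ (1 / (p - 1)) * (C₁ * (K / g)),
    by positivity, 1 + 2 * (K / g), by linarith, fun N l R m hR hm hN hl h1 h2 h3 => ?_⟩
  have hN1 : 1 ≤ N := by linarith
  have hN0 : 0 < N := by linarith
  have hl0 := hl.1
  have hlg : |l / g - 1| ≤ K / g / N := by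
    rw [div_sub_one hg0.ne', abs_div, abs_of_pos hg0, div_right_comm]
    refine (div_le_div_of_nonneg_right h3 hg0.le).trans ?_
    gcongr
    exact le_self_pow₀ hN1 two_ne_zero
  have hlg2 : |l / g - 1| ≤ 1 / 2 := by
    refine hlg.trans ?_
    rw [div_le_iff₀ hN0]
    linarith
  have hmem : l / g ∈ Set.Icc (1 / 2 : ℝ) (3 / 2) := by
    have := abs_le.1 hlg2
    exact ⟨by linarith [this.1], by linarith [this.2]⟩
  have hsq : |√(l / g) - 1| ≤ |l / g - 1| := abs_sqrt_sub_one_le (by positivity)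
  have hhalf : 1 / 2 ≤ √(l / g) := by
    have := (abs_le.1 (hsq.trans hlg2)).1
    linarith
  have hcR : √c * R = N * √(l / g) := by
    have e : c * R ^ 2 = N ^ 2 * (l / g) := by
      rw [hcg, div_mul_eq_mul_div, h1]; ring
    have := congrArg Real.sqrt e
    rwa [Real.sqrt_mul hc0.le, Real.sqrt_sq hR.le, Real.sqrt_mul (by positivity),
      Real.sqrt_sq hN0.le] at this
  refine ⟨(hsq.trans hlg).trans (by gcongr; linarith), hhalf, ?_, hcR, ?_⟩
  · obtain ⟨ρ, hρ⟩ : ∃ ρ, ρ = √c * (2 * m / √((p - 1) * ω)) := ⟨_, rfl⟩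
    have hpω : 0 < (p - 1) * ω := mul_pos (by linarith) hω
    have hρ0 : 0 ≤ ρ := by rw [hρ]; positivity
    have hρ2 : ρ ^ 2 = m ^ 2 / (1 - g) := by
      have : p - 1 ≠ 0 := by linarith
      have h4 : 1 - g = (p - 1) / (p + 3) := by rw [hg]; field_simp; ring
      rw [hρ, mul_pow, div_pow, Real.sq_sqrt hc0.le, Real.sq_sqrt hpω.le, hc, h4]
      field_simp
      ring
    have e : (√c * R - ρ) * (√c * R + ρ)
        = N ^ 2 * (l - g) / (g * (1 - g)) - g ^ 2 / 4 / (1 - g) := by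
      have e1 : (√c * R) ^ 2 = N ^ 2 * (l / g) := by
        rw [hcR, mul_pow, Real.sq_sqrt (by positivity)]
      have e2 : (√c * R - ρ) * (√c * R + ρ) = (√c * R) ^ 2 - ρ ^ 2 := by ring
      rw [e2, e1, hρ2, ← h2]
      field_simp
      ring
    have hbd : |(√c * R - ρ) * (√c * R + ρ)| ≤ K / (g * (1 - g)) + 1 / (1 - g) := by
      rw [e]
      refine (abs_sub _ _).trans (add_le_add ?_ ?_)
      · rw [abs_div, abs_mul, abs_of_pos (by positivity : 0 < N ^ 2),
          abs_of_pos (by positivity : 0 < g * (1 - g))]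
        gcongr
        rwa [le_div_iff₀ (by positivity), mul_comm] at h3
      · rw [abs_of_pos (by positivity)]
        gcongr
        have : g ^ 2 ≤ 1 := pow_le_one₀ hg0.le hg1.le
        linarith
    rw [← hρ]
    have hlow : N / 2 ≤ √c * R + ρ := by
      rw [hcR]
      have := mul_le_mul_of_nonneg_left hhalf hN0.le
      linarith
    rw [abs_mul, abs_of_pos (by linarith : 0 < √c * R + ρ)] at hbd
    have h5 : |√c * R - ρ| * (N / 2) ≤ K / (g * (1 - g)) + 1 / (1 - g) :=
      (mul_le_mul_of_nonneg_left hlow (abs_nonneg _)).trans hbd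
    rw [le_div_iff₀ hN0]
    linarith
  · have e : (ω / l) ^ (1 / (p - 1)) = c ^ (1 / (p - 1)) * (l / g) ^ (-(1 / (p - 1))) := by
      rw [Real.rpow_neg (by positivity), ← Real.inv_rpow (by positivity),
        ← Real.mul_rpow hc0.le (by positivity), hcg]
      congr 1
      field_simp
    have h4 := (ht _ hmem).2.1
    have e2 : (ω / l) ^ (1 / (p - 1)) - c ^ (1 / (p - 1))
        = c ^ (1 / (p - 1)) * ((l / g) ^ (-(1 / (p - 1))) - 1) := by rw [e]; ring
    rw [e2, abs_mul, abs_of_pos (by positivity)]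
    calc _ ≤ c ^ (1 / (p - 1)) * (C₁ * (K / g / N)) := by
          gcongr
          exact h4.trans (by gcongr)
      _ = c ^ (1 / (p - 1)) * (C₁ * (K / g)) / N := by ring
      _ ≤ _ := by gcongr; linarith

/-- `Qc p 1` is Lipschitz with an exponentially small constant far from the origin. -/
lemma exists_abs_Qc_one_sub_le {p : ℝ} (hp : 1 < p) : ∃ K > 0, ∀ a x y : ℝ, a ≤ x → a ≤ y →
    |Qc p 1 x - Qc p 1 y| ≤ K * exp (-a) * |x - y| := by
  obtain ⟨K, hK, hQ⟩ := exists_Qc_one_le_exp hp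
  refine ⟨K, hK, fun a x y hx hy => ?_⟩
  refine (convex_Ici a).norm_image_sub_le_of_norm_hasDerivWithin_le
    (fun z _ => (hasDerivAt_Qc_one hp z).hasDerivWithinAt) (fun z hz => ?_) hy hx
  rw [Real.norm_eq_abs, abs_neg, abs_mul, abs_of_pos (Qc_one_pos hp z)]
  have h1 := mul_le_of_le_one_right (Qc_one_pos hp z).le (abs_tanh_le_one ((p - 1) / 2 * z))
  refine h1.trans ((hQ z).trans ?_)
  have : a ≤ |z| := le_trans hz (le_abs_self z)
  gcongr

/-- Growth of the change of variable `X ↦ X ^ s`. -/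
lemma mul_rpow_sub_one_growth {s X : ℝ} (hs : 1 ≤ s) (hX : 0 < X) :
    (1 ≤ X → X - 1 ≤ X ^ s - 1) ∧ (X ≤ 1 → X ^ s - 1 ≤ X - 1) := by
  refine ⟨fun h => ?_, fun h => ?_⟩
  · have := Real.rpow_le_rpow_of_exponent_le h hs
    rw [rpow_one] at this
    linarith
  · have := Real.rpow_le_rpow_of_exponent_ge hX h hs
    rw [rpow_one] at this
    linarith

/-- Comparison of the soliton in the rescaled radial variable and in the original one. -/
lemma exists_Qc_one_shift {p σ C₀ : ℝ} (hp : 1 < p) (hσ : 0 < σ) (hC₀ : 0 < C₀) :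
    ∃ C > 0, ∀ N τ d x : ℝ, 1 ≤ N → 0 < radialScale p N x → |τ - 1| ≤ C₀ / N → 1 / 2 ≤ τ →
      |d| ≤ C₀ / N →
      (|x| ≤ 1 / 2 * N →
        |Qc p 1 x - Qc p 1 (N * τ * (radialScale p N x ^ ((p + 3) / 4) - 1) + d)| ≤ C / N) ∧
      (σ * N ≤ |x| →
        Qc p 1 (N * τ * (radialScale p N x ^ ((p + 3) / 4) - 1) + d) ≤ C / N) := by
  obtain ⟨K, hK, hQ⟩ := exists_Qc_one_le_exp hp
  obtain ⟨K', hK', hLip⟩ := exists_abs_Qc_one_sub_le hp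
  obtain ⟨Ct, hCt, htay⟩ := exists_rpow_taylor ((p + 3) / 4)
  obtain ⟨g, hg⟩ : ∃ g, g = 4 / (p + 3) := ⟨_, rfl⟩
  have hg0 : 0 < g := by rw [hg]; exact div_pos (by norm_num) (by linarith)
  have hg1 : g ≤ 1 := by rw [hg, div_le_one (by linarith)]; linarith
  have hsg : (p + 3) / 4 * g = 1 := by
    have : p + 3 ≠ 0 := by linarith
    rw [hg]; field_simp
  obtain ⟨s, hs⟩ : ∃ s, s = (p + 3) / 4 := ⟨_, rfl⟩
  have hs1 : 1 ≤ s := by rw [hs]; linarith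
  rw [← hs] at htay hsg ⊢
  obtain ⟨C₂, hC₂, he₂⟩ := exists_pow_mul_exp_neg_le 2 (half_pos hg0)
  obtain ⟨C₃, hC₃, he₃⟩ := exists_pow_mul_exp_neg_le 1 (by positivity : 0 < g / 2 * σ)
  obtain ⟨C₁, hC₁⟩ : ∃ C₁, C₁ = 2 * C₀ + (1 + C₀) * Ct := ⟨_, rfl⟩
  have hC₁0 : 0 < C₁ := by rw [hC₁]; positivity
  refine ⟨K' * exp C₀ * C₁ * (1 + C₂) + K * exp C₀ * C₃, by positivity,
    fun N τ d x hN hX hτ hτ2 hd => ?_⟩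
  have hN0 : 0 < N := by linarith
  obtain ⟨X, hXd⟩ : ∃ X, X = radialScale p N x := ⟨_, rfl⟩
  rw [← hXd] at hX ⊢
  have hX1 : X - 1 = g * x / N := by rw [hXd, hg]; unfold radialScale; ring
  obtain ⟨z, hz⟩ : ∃ z, z = N * τ * (X ^ s - 1) + d := ⟨_, rfl⟩
  rw [← hz]
  have hd1 : |d| ≤ C₀ := hd.trans (div_le_self hC₀.le hN)
  have hNX : N * (X - 1) = g * x := by rw [hX1]; field_simp
  have hgrow := mul_rpow_sub_one_growth hs1 hX
  have hside : (g / 2 * |x| - C₀ ≤ x ∧ g / 2 * |x| - C₀ ≤ z) ∨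
      (g / 2 * |x| - C₀ ≤ -x ∧ g / 2 * |x| - C₀ ≤ -z) := by
    have hd2 := abs_le.1 hd1
    have hNτ : 0 < N * τ := mul_pos hN0 (by linarith)
    have hgx : g * |x| ≤ 1 * |x| := by gcongr
    rcases le_total 0 x with h0 | h0
    · left
      rw [abs_of_nonneg h0] at hgx ⊢
      have h1 : 1 ≤ X := by
        have : 0 ≤ g * x / N := by positivity
        linarith
      have h2 := mul_le_mul_of_nonneg_left (hgrow.1 h1) hNτ.le
      have h3 : N * τ * (X - 1) = τ * (g * x) := by rw [← hNX]; ring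
      have h4 : 1 / 2 * (g * x) ≤ τ * (g * x) := mul_le_mul_of_nonneg_right hτ2 (by positivity)
      constructor
      · nlinarith
      · rw [hz]; linarith
    · right
      rw [abs_of_nonpos h0] at hgx ⊢
      have hgx0 : g * x ≤ 0 := mul_nonpos_of_nonneg_of_nonpos hg0.le h0
      have h1 : X ≤ 1 := by
        have : g * x / N ≤ 0 := div_nonpos_of_nonpos_of_nonneg hgx0 hN0.le
        linarith
      have h2 := mul_le_mul_of_nonneg_left (hgrow.2 h1) hNτ.le
      have h3 : N * τ * (X - 1) = τ * (g * x) := by rw [← hNX]; ring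
      have h4 : τ * (g * x) ≤ 1 / 2 * (g * x) := mul_le_mul_of_nonpos_right hτ2 hgx0
      constructor
      · linarith
      · rw [hz]; linarith
  have hexp : exp (-(g / 2 * |x| - C₀)) = exp C₀ * exp (-(g / 2 * |x|)) := by
    rw [← exp_add]; ring_nf
  have w1 : 0 < K' * exp C₀ * C₁ * (1 + C₂) := by positivity
  have w2 : 0 < K * exp C₀ * C₃ := by positivity
  constructor
  · intro hx
    have hmem := (radialScale_mem hp hN0 le_rfl hx).1
    rw [← hXd] at hmem
    have hE := (htay X hmem).2.2
    have e : z - x = (τ - 1) * x + τ * (N * (X ^ s - 1 - s * (X - 1))) + d := by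
      have : N * (s * (X - 1)) = x := by
        rw [mul_left_comm, hNX, ← mul_assoc, hsg, one_mul]
      rw [hz]
      linear_combination τ * this
    have hτ3 : |τ| ≤ 1 + C₀ := by
      have h1 : |τ - 1| ≤ C₀ := hτ.trans (div_le_self hC₀.le hN)
      have := abs_le.1 h1
      rw [abs_of_pos (by linarith)]
      linarith
    have hE2 : |N * (X ^ s - 1 - s * (X - 1))| ≤ Ct * x ^ 2 / N := by
      rw [abs_mul, abs_of_pos hN0]
      have h1 : (X - 1) ^ 2 ≤ x ^ 2 / N ^ 2 := by
        rw [hX1, div_pow, mul_pow]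
        have : g ^ 2 ≤ 1 := pow_le_one₀ hg0.le hg1
        have : g ^ 2 * x ^ 2 ≤ 1 * x ^ 2 := by gcongr
        gcongr
        linarith
      calc _ ≤ N * (Ct * (x ^ 2 / N ^ 2)) := by
            gcongr
            exact hE.trans (by gcongr)
        _ = _ := by field_simp
    have hxx : |x| ≤ 1 + x ^ 2 := by
      rw [← sq_abs]; nlinarith [sq_nonneg (|x| - 1), abs_nonneg x]
    have hdiff : |x - z| ≤ C₁ * (1 + x ^ 2) / N := by
      rw [abs_sub_comm, e]
      have h1 : |(τ - 1) * x| ≤ C₀ / N * (1 + x ^ 2) := by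
        rw [abs_mul]
        gcongr
      have h2 : |τ * (N * (X ^ s - 1 - s * (X - 1)))| ≤ (1 + C₀) * (Ct * x ^ 2 / N) := by
        rw [abs_mul]
        gcongr
      have h3 := (abs_add_le _ d).trans (add_le_add_left (abs_add_le ((τ - 1) * x)
        (τ * (N * (X ^ s - 1 - s * (X - 1))))) |d|)
      have e2 : C₁ * (1 + x ^ 2) / N = C₀ / N * (1 + x ^ 2) + (1 + C₀) * (Ct * x ^ 2 / N)
          + C₀ / N + (C₀ * x ^ 2 / N + (1 + C₀) * Ct / N) := by
        rw [hC₁]; ring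
      have : 0 ≤ C₀ * x ^ 2 / N + (1 + C₀) * Ct / N := by positivity
      linarith
    have hlip : |Qc p 1 x - Qc p 1 z| ≤ K' * exp (-(g / 2 * |x| - C₀)) * |x - z| := by
      rcases hside with ⟨h1, h2⟩ | ⟨h1, h2⟩
      · exact hLip _ _ _ h1 h2
      · have := hLip _ _ _ h1 h2
        rw [Qc_one_neg, Qc_one_neg, show -x - -z = -(x - z) by ring, abs_neg] at this
        exact this
    have hdec : (1 + x ^ 2) * exp (-(g / 2 * |x|)) ≤ 1 + C₂ := by
      have h1 := he₂ |x| (abs_nonneg x)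
      rw [sq_abs] at h1
      have h2 : exp (-(g / 2 * |x|)) ≤ 1 := exp_le_one_iff.2 (by
        have : 0 ≤ g / 2 * |x| := by positivity
        linarith)
      linarith
    calc _ ≤ K' * exp (-(g / 2 * |x| - C₀)) * (C₁ * (1 + x ^ 2) / N) := hlip.trans (by gcongr)
      _ = K' * exp C₀ * C₁ * ((1 + x ^ 2) * exp (-(g / 2 * |x|))) / N := by rw [hexp]; ring
      _ ≤ K' * exp C₀ * C₁ * (1 + C₂) / N := by gcongr
      _ ≤ _ := by gcongr; linarith
  · intro hx
    have hz2 : g / 2 * |x| - C₀ ≤ |z| := by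
      rcases hside with ⟨-, h2⟩ | ⟨-, h2⟩
      · exact h2.trans (le_abs_self _)
      · exact h2.trans (neg_le_abs _)
    have h3 := he₃ N hN0.le
    rw [pow_one, mul_comm, ← le_div_iff₀ hN0] at h3
    calc Qc p 1 z ≤ K * exp (-(g / 2 * |x| - C₀)) := (hQ z).trans (by gcongr)
      _ = K * exp C₀ * exp (-(g / 2 * |x|)) := by rw [hexp]; ring
      _ ≤ K * exp C₀ * exp (-(g / 2 * σ * N)) := by
          have : g / 2 * σ * N ≤ g / 2 * |x| := by rw [mul_assoc]; gcongr
          gcongr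
      _ ≤ K * exp C₀ * (C₃ / N) := by gcongr
      _ = K * exp C₀ * C₃ / N := by ring
      _ ≤ _ := by gcongr; linarith

theorem exists_radialProfile_sub_Qc_le {p ω : ℝ} (hp : 1 < p) (hω : 0 < ω) :
    ∃ C > 0, ∃ N₁ ≥ 1, ∀ (N l R m : ℝ) (U U1 : ℝ → ℝ), RadialProfile p N l U U1 → 0 < R →
      0 ≤ m → N₁ ≤ N → ω * R ^ 2 = l * N ^ 2 →
      (1 - l) * N ^ 2 + (4 / (p + 3)) ^ 2 / 4 = m ^ 2 →
      ∀ x, 0 < radialScale p N x →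
        |(ω / l) ^ (1 / (p - 1)) * (radialScale p N x ^ (-(1 / 2) : ℝ) * U x)
          - Qc p ((p + 3) * ω / 4)
            (R * radialScale p N x ^ ((p + 3) / 4) - 2 * m / √((p - 1) * ω))| ≤ C / N := by
  obtain ⟨K, hK, α, hα, σ, hσ, hσ8, N₀, hN₀, hglob⟩ := exists_radialProfile_global hp
  obtain ⟨C₀, hC₀, N₁, hN₁, hscal⟩ := exists_scaling_bound hp hω hK
  obtain ⟨C₁, hC₁, hshift⟩ := exists_Qc_one_shift hp hσ hC₀
  obtain ⟨C₂, hC₂, htay⟩ := exists_rpow_taylor (-(1 / 2))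
  obtain ⟨C₃, hC₃, hxe⟩ := exists_pow_mul_exp_neg_le 1 hα
  obtain ⟨c, hc⟩ : ∃ c, c = (p + 3) * ω / 4 := ⟨_, rfl⟩
  have hc0 : 0 < c := by rw [hc]; exact div_pos (mul_pos (by linarith) hω) (by norm_num)
  rw [← hc] at hscal ⊢
  obtain ⟨A₀, hA₀⟩ : ∃ A₀, A₀ = c ^ (1 / (p - 1)) := ⟨_, rfl⟩
  have hA₀0 : 0 < A₀ := by rw [hA₀]; positivity
  refine ⟨C₀ * (C₂ * K + K) + A₀ * (C₂ * C₃ * K + K + C₁ + K + C₁), by positivity,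
    N₀ + N₁, by linarith, fun N l R m U U1 H hR hm hN h1 h2 x hX => ?_⟩
  have hN1 : 1 ≤ N := by linarith
  have hN0 : 0 < N := by linarith
  obtain ⟨hl, hin, hout⟩ := hglob N l U U1 H (by linarith)
  obtain ⟨hτ, hτ2, hd, hcR, hA⟩ := hscal N l R m hR hm (by linarith) H.l_mem h1 h2 hl
  obtain ⟨hs1, hs2⟩ := hshift N _ _ x hN1 hX hτ hτ2 hd
  obtain ⟨A, hAd⟩ : ∃ A, A = (ω / l) ^ (1 / (p - 1)) := ⟨_, rfl⟩
  rw [← hAd, ← hA₀] at hA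
  rw [← hAd, Qc_eq_scaling hp hc0, ← hA₀]
  have ez : √c * (R * radialScale p N x ^ ((p + 3) / 4) - 2 * m / √((p - 1) * ω))
      = N * √(l / (4 / (p + 3))) * (radialScale p N x ^ ((p + 3) / 4) - 1)
        + (√c * R - √c * (2 * m / √((p - 1) * ω))) := by
    linear_combination (radialScale p N x ^ ((p + 3) / 4) - 1) * hcR
  rw [ez]
  obtain ⟨z, hz⟩ : ∃ z, z = N * √(l / (4 / (p + 3))) * (radialScale p N x ^ ((p + 3) / 4) - 1)
        + (√c * R - √c * (2 * m / √((p - 1) * ω))) := ⟨_, rfl⟩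
  rw [← hz] at hs1 hs2 ⊢
  have hU := H.pos x hX
  obtain ⟨V, hV⟩ : ∃ V, V = radialScale p N x ^ (-(1 / 2) : ℝ) := ⟨_, rfl⟩
  have hV0 : 0 < V := by rw [hV]; positivity
  have hQz := Qc_one_pos hp z
  rw [← hV]
  have e : A * (V * U x) - A₀ * Qc p 1 z
      = (A - A₀) * (V * U x) + A₀ * (V * U x - Qc p 1 z) := by ring
  rw [e]
  have hfin : ∀ a b : ℝ, V * U x ≤ a → |V * U x - Qc p 1 z| ≤ b / N →
      |(A - A₀) * (V * U x) + A₀ * (V * U x - Qc p 1 z)| ≤ (C₀ * a + A₀ * b) / N := by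
    intro a b ha hb
    refine (abs_add_le _ _).trans ?_
    rw [abs_mul, abs_mul A₀, abs_of_pos hA₀0, abs_of_pos (mul_pos hV0 hU)]
    calc _ ≤ C₀ / N * a + A₀ * (b / N) := by gcongr
      _ = _ := by ring
  rcases le_total |x| (σ * N) with hx | hx
  · obtain ⟨hmem, hX1⟩ := radialScale_mem hp hN0 (by linarith) hx
    obtain ⟨t1, t2, -⟩ := htay _ hmem
    rw [← hV] at t1 t2
    obtain ⟨u1, u2⟩ := hin x hx
    have hexp : exp (-(α * |x|)) ≤ 1 := exp_le_one_iff.2 (by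
      have : 0 ≤ α * |x| := by positivity
      linarith)
    have hUK : U x ≤ K := u1.trans (mul_le_of_le_one_right hK.le hexp)
    have hxe' := hxe |x| (abs_nonneg x)
    rw [pow_one] at hxe'
    have b1 : |(V - 1) * U x| ≤ C₂ * C₃ * K / N := by
      rw [abs_mul, abs_of_pos hU]
      calc _ ≤ C₂ * (|x| / N) * (K * exp (-(α * |x|))) := by
            gcongr
            exact t2.trans (by gcongr)
        _ = C₂ * (|x| * exp (-(α * |x|))) * K / N := by ring
        _ ≤ _ := by gcongr
    have b2 := hs1 (hx.trans (mul_le_mul_of_nonneg_right (by linarith) hN0.le))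
    have b3 : |V * U x - Qc p 1 z| ≤ (C₂ * C₃ * K + K + C₁) / N := by
      have e2 : V * U x - Qc p 1 z
          = (V - 1) * U x + (U x - Qc p 1 x) + (Qc p 1 x - Qc p 1 z) := by ring
      rw [e2, add_div, add_div]
      exact (abs_add_three _ _ _).trans (add_le_add (add_le_add b1 u2) b2)
    refine (hfin (C₂ * K) _ (mul_le_mul t1 hUK hU.le hC₂.le) b3).trans ?_
    gcongr
    · linarith
    · linarith
  · have b1 := hout x hX hx
    rw [← hV] at b1
    have b2 := hs2 hx
    have b3 : |V * U x - Qc p 1 z| ≤ (K + C₁) / N := by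
      refine (abs_sub _ _).trans ?_
      rw [abs_of_pos (mul_pos hV0 hU), abs_of_pos hQz, add_div]
      exact add_le_add b1 b2
    have w : 0 < C₂ * C₃ * K := by positivity
    refine (hfin K _ (b1.trans (div_le_self hK.le hN1)) b3).trans ?_
    gcongr
    · have : 0 < C₂ * K := by positivity
      linarith
    · linarith

/-! ### Radial vortex profiles -/

/-- A positive decaying solution of the radial vortex profile equation. -/
structure VortexProfile (p ω : ℝ) (m : ℕ) (φ φ1 : ℝ → ℝ) : Prop where
  one_lt : 1 < p
  omega_pos : 0 < ω
  one_le : 1 ≤ m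
  hasDerivAt : ∀ r, 0 < r → HasDerivAt φ (φ1 r) r
  hasDerivAt' : ∀ r, 0 < r →
    HasDerivAt φ1 (-(φ1 r / r) + (ω + (m : ℝ) ^ 2 / r ^ 2) * φ r - φ r ^ p) r
  pos : ∀ r, 0 < r → 0 < φ r
  near_zero : ∃ L : ℝ, Tendsto (fun r => φ r / r ^ m) (nhdsWithin 0 (Set.Ioi 0)) (nhds L)
  at_top : Tendsto φ atTop (nhds 0)

namespace VortexProfile

variable {p ω : ℝ} {m : ℕ} {φ φ1 : ℝ → ℝ}

lemma eventually_le_near_zero (H : VortexProfile p ω m φ φ1) :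
    ∃ C > 0, ∀ᶠ r in nhdsWithin 0 (Set.Ioi 0), φ r ≤ C * r := by
  obtain ⟨L, hL⟩ := H.near_zero
  refine ⟨|L| + 1, by positivity, ?_⟩
  have h1 : Set.Ioo (0 : ℝ) 1 ∈ nhdsWithin (0 : ℝ) (Set.Ioi 0) := Ioo_mem_nhdsGT one_pos
  filter_upwards [h1, hL.eventually (gt_mem_nhds (lt_of_le_of_lt (le_abs_self L)
    (lt_add_one _)))] with r hr h2
  rw [div_lt_iff₀ (pow_pos hr.1 m)] at h2
  refine h2.le.trans ?_
  have : r ^ m ≤ r ^ 1 := pow_le_pow_of_le_one hr.1.le hr.2.le H.one_le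
  rw [pow_one] at this
  gcongr

lemma eventually_le_at_top (H : VortexProfile p ω m φ φ1) :
    ∃ C > 0, ∀ᶠ r in atTop, φ r ≤ C / r ^ 2 := by
  have hp := H.one_lt
  have hω := H.omega_pos
  have hη : 0 < (ω / 2) ^ (1 / (p - 1)) := by positivity
  obtain ⟨r₁, hr₁⟩ := eventually_atTop.1 (H.at_top.eventually (gt_mem_nhds hη))
  obtain ⟨r₀, hr₀⟩ : ∃ r₀, r₀ = max r₁ (max 1 (8 / ω)) := ⟨_, rfl⟩
  have h1 : r₁ ≤ r₀ := by rw [hr₀]; exact le_max_left _ _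
  have h2 : 1 ≤ r₀ := by rw [hr₀]; exact (le_max_left _ _).trans (le_max_right _ _)
  have h3 : 8 / ω ≤ r₀ := by rw [hr₀]; exact (le_max_right _ _).trans (le_max_right _ _)
  have hr00 : 0 < r₀ := by linarith
  have hφ0 := H.pos r₀ hr00
  obtain ⟨C, hC⟩ : ∃ C, C = φ r₀ * r₀ ^ 2 := ⟨_, rfl⟩
  have hC0 : 0 < C := by rw [hC]; positivity
  refine ⟨C, hC0, eventually_atTop.2 ⟨r₀, fun r hr => ?_⟩⟩
  have hr0 : 0 < r := by linarith
  suffices h : ∀ᶠ T in atTop, φ r - C / r ^ 2 ≤ φ T by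
    have := ge_of_tendsto H.at_top h
    linarith
  filter_upwards [eventually_ge_atTop r] with T hT
  have hT0 : 0 < T := by linarith
  refine le_of_second_deriv_pos (a := r₀) (b := T) (D := φ T) (f := fun r => φ r - C / r ^ 2)
    (f' := fun r => φ1 r + 2 * C / r ^ 3)
    (f'' := fun r => -(φ1 r / r) + (ω + (m : ℝ) ^ 2 / r ^ 2) * φ r - φ r ^ p - 6 * C / r ^ 4)
    ?_ ?_ ?_ ?_ ?_ r ⟨hr, hT⟩
  · intro x hx
    have hx0 : 0 < x := hr00.trans_le hx.1
    refine ((H.hasDerivAt x hx0).sub ((hasDerivAt_const x C).div (hasDerivAt_pow 2 x)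
      (by positivity))).congr_deriv ?_
    field_simp
    ring
  · intro x hx
    have hx0 : 0 < x := hr00.trans_le hx.1
    refine ((H.hasDerivAt' x hx0).add ((hasDerivAt_const x (2 * C)).div (hasDerivAt_pow 3 x)
      (by positivity))).congr_deriv ?_
    field_simp
    ring
  · have e : C / r₀ ^ 2 = φ r₀ := by rw [hC]; field_simp
    rw [e, sub_self]
    exact (H.pos T hT0).le
  · have : 0 < C / T ^ 2 := by positivity
    linarith
  · intro x hx hD h0
    have hx0 : 0 < x := hr00.trans_le hx.1
    have hφx := H.pos x hx0
    have hpos : 0 < φ x - C / x ^ 2 := (H.pos T hT0).trans hD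
    have hsmall : φ x ^ (p - 1) ≤ ω / 2 := by
      have h4 := (hr₁ x (h1.trans hx.1)).le
      have h5 := rpow_le_rpow hφx.le h4 (by linarith : 0 ≤ p - 1)
      rwa [← rpow_mul (by positivity), one_div_mul_cancel (by linarith), rpow_one] at h5
    have e1 : φ1 x / x = -(2 * C / x ^ 4) := by
      have : φ1 x = -(2 * C / x ^ 3) := by linarith
      rw [this]; field_simp
    have e2 : φ x ^ p = φ x * φ x ^ (p - 1) := rpow_eq_mul_rpow_sub_one hφx
    have h6 : φ x * φ x ^ (p - 1) ≤ φ x * (ω / 2) := by gcongr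
    have h7 : 0 ≤ (m : ℝ) ^ 2 / x ^ 2 * φ x := by positivity
    have h8 : 4 * C / x ^ 4 ≤ ω / 2 * (C / x ^ 2) := by
      rw [div_le_iff₀ (by positivity)]
      have e3 : ω / 2 * (C / x ^ 2) * x ^ 4 = ω / 2 * C * x ^ 2 := by field_simp
      rw [e3]
      have h9 : 8 ≤ ω * x := by
        rw [div_le_iff₀ hω] at h3
        have := mul_le_mul_of_nonneg_right hx.1 hω.le
        linarith
      have h10 : x ≤ x ^ 2 := le_self_pow₀ (h2.trans hx.1) two_ne_zero
      have h11 : ω * x * C ≤ ω * x ^ 2 * C := by gcongr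
      have h12 : 8 * C ≤ ω * x * C := by gcongr
      linarith
    have h13 : 0 < ω / 2 * (φ x - C / x ^ 2) := by positivity
    rw [e1, e2]
    have e4 : 4 * C / x ^ 4 = 6 * C / x ^ 4 - 2 * C / x ^ 4 := by ring
    linarith

/-- The weighted profile `r ^ β * φ r` attains its maximum. -/
lemma exists_isMax (H : VortexProfile p ω m φ φ1) {β : ℝ} (hβ : 0 < β) (hβ2 : β ≤ 1) :
    ∃ R, 0 < R ∧ β * φ R + R * φ1 R = 0 := by
  obtain ⟨C₁, hC₁, h1⟩ := H.eventually_le_near_zero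
  obtain ⟨C₂, hC₂, h2⟩ := H.eventually_le_at_top
  have hf1 : 0 < φ 1 := H.pos 1 one_pos
  have hz : ∀ᶠ r in nhdsWithin (0 : ℝ) (Set.Ioi 0), r ^ β * φ r < φ 1 := by
    have h3 : Set.Ioo (0 : ℝ) (min 1 (φ 1 / C₁)) ∈ nhdsWithin (0 : ℝ) (Set.Ioi 0) :=
      Ioo_mem_nhdsGT (by positivity)
    filter_upwards [h1, h3] with r hr hr2
    have a1 : r < 1 := hr2.2.trans_le (min_le_left _ _)
    have a2 : r < φ 1 / C₁ := hr2.2.trans_le (min_le_right _ _)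
    rw [lt_div_iff₀ hC₁] at a2
    have a3 : r ^ β ≤ 1 := rpow_le_one hr2.1.le a1.le hβ.le
    calc r ^ β * φ r ≤ 1 * φ r := mul_le_mul_of_nonneg_right a3 (H.pos r hr2.1).le
      _ < φ 1 := by linarith
  have hi : ∀ᶠ r in atTop, r ^ β * φ r < φ 1 := by
    filter_upwards [h2, eventually_gt_atTop 1, eventually_gt_atTop (C₂ / φ 1)] with r hr a1 a2
    have hr0 : 0 < r := by linarith
    rw [div_lt_iff₀ hf1] at a2
    have a3 : r ^ β ≤ r := by
      have := rpow_le_rpow_of_exponent_le a1.le hβ2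
      rwa [rpow_one] at this
    calc r ^ β * φ r ≤ r * (C₂ / r ^ 2) := mul_le_mul a3 hr (H.pos r hr0).le hr0.le
      _ = C₂ / r := by field_simp
      _ < φ 1 := by rw [div_lt_iff₀ hr0]; linarith
  obtain ⟨b, hb⟩ := eventually_atTop.1 hi
  obtain ⟨a, ha0, ha⟩ := mem_nhdsGT_iff_exists_Ioo_subset.1 hz
  have ha0' : 0 < a := ha0
  have hd : ∀ r, 0 < r → HasDerivAt (fun r => r ^ β * φ r)
      (β * r ^ (β - 1) * φ r + r ^ β * φ1 r) r := fun r hr =>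
    (hasDerivAt_rpow_const (Or.inl hr.ne')).mul (H.hasDerivAt r hr)
  obtain ⟨a', ha'⟩ : ∃ a', a' = min (a / 2) 1 := ⟨_, rfl⟩
  obtain ⟨b', hb'⟩ : ∃ b', b' = max b 1 := ⟨_, rfl⟩
  have ha'0 : 0 < a' := by rw [ha']; positivity
  have ha'1 : a' ≤ 1 := by rw [ha']; exact min_le_right _ _
  have hb'1 : 1 ≤ b' := by rw [hb']; exact le_max_right _ _
  obtain ⟨R, hR, hmax⟩ := isCompact_Icc.exists_isMaxOn (s := Set.Icc a' b') ⟨1, ha'1, hb'1⟩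
    (f := fun r => r ^ β * φ r) (fun r hr =>
      (hd r (ha'0.trans_le hr.1)).continuousAt.continuousWithinAt)
  have hR0 : 0 < R := ha'0.trans_le hR.1
  have hR1 : φ 1 ≤ R ^ β * φ R := by
    have := hmax (⟨ha'1, hb'1⟩ : (1 : ℝ) ∈ Set.Icc a' b')
    simpa using this
  have hloc : IsLocalMax (fun r => r ^ β * φ r) R := by
    filter_upwards [lt_mem_nhds hR0] with r hr
    rcases lt_or_ge r a' with h | h
    · have : r ∈ Set.Ioo 0 a := ⟨hr, by
        have : a' ≤ a / 2 := by rw [ha']; exact min_le_left _ _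
        linarith⟩
      exact (ha this : r ^ β * φ r < φ 1).le.trans hR1
    rcases lt_or_ge b' r with h' | h'
    · exact (hb r (by
        have : b ≤ b' := by rw [hb']; exact le_max_left _ _
        linarith)).le.trans hR1
    · exact hmax ⟨h, h'⟩
  have h0 := hloc.hasDerivAt_eq_zero (hd R hR0)
  refine ⟨R, hR0, ?_⟩
  rw [rpow_sub_one hR0.ne'] at h0
  have e : β * (R ^ β / R) * φ R + R ^ β * φ1 R = R ^ β / R * (β * φ R + R * φ1 R) := by
    field_simp
  rw [e, mul_eq_zero] at h0
  exact h0.resolve_left (by positivity)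

end VortexProfile

namespace VortexProfile

variable {p ω : ℝ} {m : ℕ} {φ φ1 : ℝ → ℝ}

/-- The weighted squared profile tends to zero in the rescaled variable, at both ends. -/
lemma tendsto_weighted_sq (H : VortexProfile p ω m φ φ1) {R l a : ℝ} (hR : 0 < R)
    (hl : l ∈ Set.Ioo (0 : ℝ) 1) :
    Tendsto (fun X : ℝ => (l * X ^ ((p - 1) / 2) + (1 - l) * X ^ (-2 : ℝ)) *
      (a * (X ^ (1 / 2 : ℝ) * φ (R * X ^ ((p + 3) / 4)))) ^ 2)
      (nhdsWithin 0 (Set.Ioi 0)) (nhds 0) ∧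
    Tendsto (fun X : ℝ => (l * X ^ ((p - 1) / 2) + (1 - l) * X ^ (-2 : ℝ)) *
      (a * (X ^ (1 / 2 : ℝ) * φ (R * X ^ ((p + 3) / 4)))) ^ 2) atTop (nhds 0) := by
  have hp := H.one_lt
  have hl0 := hl.1
  have hl1 : 0 < 1 - l := by linarith [hl.2]
  have hs : 1 ≤ (p + 3) / 4 := by linarith
  have hs0 : 0 < (p + 3) / 4 := by linarith
  obtain ⟨C₁, hC₁, h1⟩ := H.eventually_le_near_zero
  obtain ⟨C₂, hC₂, h2⟩ := H.eventually_le_at_top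
  have hsq : ∀ X : ℝ, 0 < X → (X ^ (1 / 2 : ℝ)) ^ 2 = X := fun X hX => by
    rw [← rpow_natCast, ← rpow_mul hX.le]; norm_num
  have hm2 : ∀ X : ℝ, 0 < X → X ^ (-2 : ℝ) = (X ^ 2)⁻¹ := fun X hX => by
    rw [rpow_neg hX.le]; norm_num
  have hq : ∀ X : ℝ, 0 < X → (X ^ ((p + 3) / 4)) ^ 2 = X ^ ((p - 1) / 2) * X ^ 2 :=
    fun X hX => by
    rw [← rpow_natCast, ← rpow_mul hX.le, ← rpow_natCast X 2, ← rpow_add hX]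
    congr 1
    push_cast
    ring
  constructor
  · have htr : Tendsto (fun X : ℝ => R * X ^ ((p + 3) / 4)) (nhdsWithin 0 (Set.Ioi 0))
        (nhdsWithin 0 (Set.Ioi 0)) := by
      refine tendsto_nhdsWithin_iff.2 ⟨?_, ?_⟩
      · have : ContinuousAt (fun X : ℝ => R * X ^ ((p + 3) / 4)) 0 :=
          (continuousAt_rpow_const _ _ (Or.inr hs0.le)).const_mul R |>.congr (by rfl)
        have h := this.tendsto
        simp only [zero_rpow hs0.ne', mul_zero] at h
        exact h.mono_left nhdsWithin_le_nhds
      · filter_upwards [self_mem_nhdsWithin] with X hX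
        have : (0 : ℝ) < X := hX
        have : 0 < R * X ^ ((p + 3) / 4) := by positivity
        exact this
    have h3 : Set.Ioo (0 : ℝ) 1 ∈ nhdsWithin (0 : ℝ) (Set.Ioi 0) := Ioo_mem_nhdsGT one_pos
    refine squeeze_zero' (g := fun X => a ^ 2 * (C₁ * R) ^ 2 * X) ?_ ?_ ?_
    · filter_upwards [h3] with X hX
      have := hX.1
      positivity
    · filter_upwards [h3, htr.eventually h1] with X hX hb
      have hX0 := hX.1
      have e1 : X ^ ((p + 3) / 4) ≤ X := by
        have := rpow_le_rpow_of_exponent_ge hX0 hX.2.le hs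
        rwa [rpow_one] at this
      have e2 : φ (R * X ^ ((p + 3) / 4)) ≤ C₁ * R * X := by
        refine hb.trans ?_
        rw [mul_assoc]
        gcongr
      have e3 := pow_le_pow_left₀ (H.pos _ (by positivity : 0 < R * X ^ ((p + 3) / 4))).le e2 2
      have e4 : X ^ ((p - 1) / 2) ≤ X ^ (-2 : ℝ) :=
        rpow_le_rpow_of_exponent_ge hX0 hX.2.le (by linarith)
      have e5 : l * X ^ ((p - 1) / 2) + (1 - l) * X ^ (-2 : ℝ) ≤ (X ^ 2)⁻¹ := by
        rw [← hm2 X hX0]; nlinarith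
      calc _ = (l * X ^ ((p - 1) / 2) + (1 - l) * X ^ (-2 : ℝ)) *
            (a ^ 2 * (X * φ (R * X ^ ((p + 3) / 4)) ^ 2)) := by
              rw [mul_pow, mul_pow, hsq X hX0]
        _ ≤ (X ^ 2)⁻¹ * (a ^ 2 * (X * (C₁ * R * X) ^ 2)) := by gcongr
        _ = a ^ 2 * (C₁ * R) ^ 2 * X := by field_simp
    · have : Tendsto (fun X : ℝ => a ^ 2 * (C₁ * R) ^ 2 * X) (nhds 0)
          (nhds (a ^ 2 * (C₁ * R) ^ 2 * 0)) := tendsto_id.const_mul _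
      rw [mul_zero] at this
      exact this.mono_left nhdsWithin_le_nhds
  · have htr : Tendsto (fun X : ℝ => R * X ^ ((p + 3) / 4)) atTop atTop :=
      (tendsto_rpow_atTop hs0).const_mul_atTop hR
    refine squeeze_zero' (g := fun X => a ^ 2 * (C₂ / R ^ 2) ^ 2 * X⁻¹) ?_ ?_ ?_
    · filter_upwards [eventually_gt_atTop 0] with X hX
      positivity
    · filter_upwards [eventually_ge_atTop 1, htr.eventually h2] with X hX1 hb
      have hX0 : 0 < X := by linarith
      have e0 : 1 ≤ X ^ ((p - 1) / 2) := one_le_rpow hX1 (by linarith)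
      have e2 : φ (R * X ^ ((p + 3) / 4)) ≤ C₂ / R ^ 2 * (X ^ ((p - 1) / 2) * X ^ 2)⁻¹ := by
        refine hb.trans (le_of_eq ?_)
        rw [mul_pow, hq X hX0]
        field_simp
      have e3 := pow_le_pow_left₀ (H.pos _ (by positivity : 0 < R * X ^ ((p + 3) / 4))).le e2 2
      have e4 : X ^ (-2 : ℝ) ≤ X ^ ((p - 1) / 2) :=
        rpow_le_rpow_of_exponent_le hX1 (by linarith)
      have e5 : l * X ^ ((p - 1) / 2) + (1 - l) * X ^ (-2 : ℝ) ≤ X ^ ((p - 1) / 2) := by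
        nlinarith
      calc _ = (l * X ^ ((p - 1) / 2) + (1 - l) * X ^ (-2 : ℝ)) *
            (a ^ 2 * (X * φ (R * X ^ ((p + 3) / 4)) ^ 2)) := by
              rw [mul_pow, mul_pow, hsq X hX0]
        _ ≤ X ^ ((p - 1) / 2) *
            (a ^ 2 * (X * (C₂ / R ^ 2 * (X ^ ((p - 1) / 2) * X ^ 2)⁻¹) ^ 2)) := by gcongr
        _ = a ^ 2 * (C₂ / R ^ 2) ^ 2 * (X⁻¹ * ((X ^ ((p - 1) / 2))⁻¹ * (X ^ 2)⁻¹)) := by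
              field_simp
        _ ≤ a ^ 2 * (C₂ / R ^ 2) ^ 2 * (X⁻¹ * (1 * 1)) := by
              have e6 : (X ^ ((p - 1) / 2))⁻¹ ≤ 1 := inv_le_one_of_one_le₀ e0
              have e7 : (X ^ 2)⁻¹ ≤ 1 := inv_le_one_of_one_le₀ (one_le_pow₀ hX1)
              gcongr
        _ = a ^ 2 * (C₂ / R ^ 2) ^ 2 * X⁻¹ := by ring
    · have := tendsto_inv_atTop_zero.const_mul (a ^ 2 * (C₂ / R ^ 2) ^ 2)
      rwa [mul_zero] at this

lemma exists_radialProfile (H : VortexProfile p ω m φ φ1) : ∃ N l R : ℝ, 0 < R ∧ 0 < N ∧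
    (m : ℝ) / 2 ≤ N ∧ ω * R ^ 2 = l * N ^ 2 ∧
    (1 - l) * N ^ 2 + (4 / (p + 3)) ^ 2 / 4 = (m : ℝ) ^ 2 ∧ ∃ U U1 : ℝ → ℝ,
      RadialProfile p N l U U1 ∧ ∀ x, 0 < radialScale p N x →
        (ω / l) ^ (1 / (p - 1)) * (radialScale p N x ^ (-(1 / 2) : ℝ) * U x)
          = φ (R * radialScale p N x ^ ((p + 3) / 4)) := by
  have hp := H.one_lt
  have hω := H.omega_pos
  have hp3 : 0 < p + 3 := by linarith
  have hm1 : (1 : ℝ) ≤ m := by exact_mod_cast H.one_le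
  have hγ0 : 0 < 4 / (p + 3) := by positivity
  have hγ1 : 4 / (p + 3) ≤ 1 := by rw [div_le_one hp3]; linarith
  have hsγ : (p + 3) / 4 * (4 / (p + 3)) = 1 := by field_simp
  obtain ⟨γ, hγ⟩ : ∃ γ, γ = 4 / (p + 3) := ⟨_, rfl⟩
  rw [← hγ] at hγ0 hγ1 hsγ ⊢
  obtain ⟨R, hR, hRmax⟩ := H.exists_isMax (β := γ / 2) (by positivity) (by linarith)
  obtain ⟨N, hN⟩ : ∃ N, N = √(ω * R ^ 2 + m ^ 2 - γ ^ 2 / 4) := ⟨_, rfl⟩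
  have hmγ : (m : ℝ) ^ 2 / 4 ≤ m ^ 2 - γ ^ 2 / 4 := by nlinarith
  have hmγ0 : 0 < (m : ℝ) ^ 2 - γ ^ 2 / 4 := by nlinarith
  have hωR : 0 < ω * R ^ 2 := by positivity
  have hNsq : N ^ 2 = ω * R ^ 2 + m ^ 2 - γ ^ 2 / 4 := by
    rw [hN, sq_sqrt]; linarith
  have hN0 : 0 < N := by rw [hN]; apply sqrt_pos.2; linarith
  have hNm : (m : ℝ) / 2 ≤ N := by
    apply le_of_sq_le_sq _ hN0.le
    rw [hNsq]; linarith [div_pow (m : ℝ) 2 2]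
  obtain ⟨l, hl⟩ : ∃ l, l = ω * R ^ 2 / N ^ 2 := ⟨_, rfl⟩
  have hlN : ω * R ^ 2 = l * N ^ 2 := by rw [hl]; field_simp
  have hl0 : 0 < l := by rw [hl]; positivity
  have hl1 : l < 1 := by rw [hl, div_lt_one (by positivity)]; linarith
  have hlm : (1 - l) * N ^ 2 + γ ^ 2 / 4 = (m : ℝ) ^ 2 := by
    have : (1 - l) * N ^ 2 = N ^ 2 - l * N ^ 2 := by ring
    rw [this, ← hlN, hNsq]; ring
  obtain ⟨A, hA⟩ : ∃ A, A = (ω / l) ^ (1 / (p - 1)) := ⟨_, rfl⟩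
  have hA0 : 0 < A := by rw [hA]; positivity
  have hAp : A ^ (p - 1) = N ^ 2 / R ^ 2 := by
    rw [hA, ← rpow_mul (by positivity), one_div_mul_cancel (by linarith), rpow_one, div_eq_div_iff
      hl0.ne' (by positivity)]
    linarith
  have hscale : ∀ x, HasDerivAt (radialScale p N) (γ / N) x := fun x => by
    rw [hγ]; exact hasDerivAt_radialScale
  have hr : ∀ x, 0 < radialScale p N x →
      HasDerivAt (fun x => R * radialScale p N x ^ ((p + 3) / 4))
        (R * radialScale p N x ^ ((p + 3) / 4) / (N * radialScale p N x)) x := fun x hx => by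
    refine (((hscale x).rpow_const (p := (p + 3) / 4) (Or.inl hx.ne')).const_mul R).congr_deriv ?_
    rw [rpow_sub_one hx.ne']
    have e : γ / N * ((p + 3) / 4) = 1 / N := by
      rw [div_mul_eq_mul_div, mul_comm γ, hsγ]
    rw [e]
    field_simp
  have hr0 : ∀ x, 0 < radialScale p N x → 0 < R * radialScale p N x ^ ((p + 3) / 4) :=
    fun x hx => by positivity
  refine ⟨N, l, R, hR, hN0, hNm, hlN, hlm,
    fun x => A⁻¹ * (radialScale p N x ^ (1 / 2 : ℝ) * φ (R * radialScale p N x ^ ((p + 3) / 4))),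
    fun x => A⁻¹ * (N⁻¹ * (radialScale p N x ^ (-(1 / 2) : ℝ) *
      (γ / 2 * φ (R * radialScale p N x ^ ((p + 3) / 4)) +
        R * radialScale p N x ^ ((p + 3) / 4) * φ1 (R * radialScale p N x ^ ((p + 3) / 4))))),
    ⟨hp, hN0, ⟨hl0, hl1⟩, ?_, ?_, ?_, ?_, ?_, ?_⟩, ?_⟩
  · intro x hx
    have hd := ((((hscale x).rpow_const (p := (1 / 2 : ℝ)) (Or.inl hx.ne')).mul
      ((H.hasDerivAt _ (hr0 x hx)).comp x (hr x hx))).const_mul A⁻¹)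
    refine hd.congr_deriv ?_
    simp only [Function.comp_apply]
    generalize φ1 (R * radialScale p N x ^ ((p + 3) / 4)) = F1
    generalize φ (R * radialScale p N x ^ ((p + 3) / 4)) = F
    have e1 : radialScale p N x ^ (1 / 2 : ℝ)
        = radialScale p N x ^ (-(1 / 2) : ℝ) * radialScale p N x := by
      rw [← rpow_add_one hx.ne']; norm_num
    rw [show (1 / 2 - 1 : ℝ) = -(1 / 2) by norm_num, e1]
    field_simp
  · intro x hx
    have hd := ((((((hscale x).rpow_const (p := (-(1 / 2) : ℝ)) (Or.inl hx.ne')).mul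
      ((((H.hasDerivAt _ (hr0 x hx)).comp x (hr x hx)).const_mul (γ / 2)).add
        ((hr x hx).mul ((H.hasDerivAt' _ (hr0 x hx)).comp x (hr x hx)))))).const_mul N⁻¹).const_mul
          A⁻¹)
    refine hd.congr_deriv ?_
    simp only [Function.comp_apply, Pi.add_apply, Pi.mul_apply]
    have hF := H.pos _ (hr0 x hx)
    have e3 : (R * radialScale p N x ^ ((p + 3) / 4)) ^ 2
        = R ^ 2 * (radialScale p N x ^ ((p - 1) / 2) * radialScale p N x ^ 2) := by
      rw [mul_pow, ← rpow_natCast (radialScale p N x ^ ((p + 3) / 4)), ← rpow_mul hx.le,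
        ← rpow_natCast (radialScale p N x) 2, ← rpow_add hx]
      congr 2
      push_cast
      ring
    have e1 : radialScale p N x ^ (-(1 / 2) : ℝ)
        = radialScale p N x ^ (1 / 2 : ℝ) / radialScale p N x := by
      rw [← rpow_sub_one hx.ne']; norm_num
    have e2 : radialScale p N x ^ (-(1 / 2) - 1 : ℝ)
        = radialScale p N x ^ (1 / 2 : ℝ) / radialScale p N x ^ 2 := by
      rw [rpow_sub_one hx.ne', e1]; field_simp
    have e4 : radialScale p N x ^ (-2 : ℝ) = (radialScale p N x ^ 2)⁻¹ := by
      rw [rpow_neg hx.le]; norm_num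
    have e5 : (radialScale p N x ^ (1 / 2 : ℝ)) ^ p
        = radialScale p N x ^ (1 / 2 : ℝ) * radialScale p N x ^ ((p - 1) / 2) := by
      rw [← rpow_mul hx.le, ← rpow_add hx]; congr 1; ring
    have e6 : A⁻¹ ^ p = A⁻¹ * (R ^ 2 / N ^ 2) := by
      rw [rpow_eq_mul_rpow_sub_one (inv_pos.2 hA0), inv_rpow hA0.le, hAp, inv_div]
    have hrx := hr0 x hx
    rw [mul_rpow (by positivity) (by positivity), mul_rpow (by positivity) hF.le, e5, e6, e2, e1,
      radialPot, e4]
    generalize φ1 (R * radialScale p N x ^ ((p + 3) / 4)) = F1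
    generalize φ (R * radialScale p N x ^ ((p + 3) / 4)) = F
    generalize R * radialScale p N x ^ ((p + 3) / 4) = r at *
    generalize radialScale p N x ^ (1 / 2 : ℝ) = t
    generalize radialScale p N x ^ ((p - 1) / 2) = q at *
    generalize radialScale p N x = X at *
    generalize F ^ p = G
    have e7 : A⁻¹ * (t / X ^ 2) / N ^ 2 * ((ω * r ^ 2 + m ^ 2 - γ ^ 2 / 4) * F - r ^ 2 * G)
        = (l * q + (1 - l) * (X ^ 2)⁻¹) * (A⁻¹ * (t * F))
          - A⁻¹ * (R ^ 2 / N ^ 2) * (t * q * G) := by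
      have e8 : ω * r ^ 2 + m ^ 2 - γ ^ 2 / 4 = N ^ 2 * (l * q * X ^ 2 + (1 - l)) := by
        rw [e3, ← hlm]
        linear_combination (q * X ^ 2) * hlN
      rw [e8, e3]
      field_simp
    rw [← e7]
    field_simp
    ring
  · intro x hx
    have := H.pos _ (hr0 x hx)
    positivity
  · simp only [radialScale_zero, one_rpow, mul_one]
    rw [hRmax]
    simp
  · have ht : Tendsto (radialScale p N)
        (nhdsWithin (-(N * (p + 3) / 4)) (Set.Ioi (-(N * (p + 3) / 4))))
        (nhdsWithin 0 (Set.Ioi 0)) := by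
      refine tendsto_nhdsWithin_iff.2 ⟨?_, ?_⟩
      · have h := (hscale (-(N * (p + 3) / 4))).continuousAt.tendsto
        have e : radialScale p N (-(N * (p + 3) / 4)) = 0 := by
          unfold radialScale; field_simp; ring
        rw [e] at h
        exact h.mono_left nhdsWithin_le_nhds
      · filter_upwards [self_mem_nhdsWithin] with x hx
        exact (radialScale_pos_iff hp hN0).2 hx
    exact (H.tendsto_weighted_sq (a := A⁻¹) hR ⟨hl0, hl1⟩).1.comp ht
  · have ht : Tendsto (radialScale p N) atTop atTop := by
      have h : Tendsto (fun x : ℝ => 4 / (p + 3) * x / N) atTop atTop :=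
        (tendsto_id.const_mul_atTop (by positivity)).atTop_div_const hN0
      exact tendsto_atTop_add_const_left _ 1 h
    exact (H.tendsto_weighted_sq (a := A⁻¹) hR ⟨hl0, hl1⟩).2.comp ht
  · intro x hx
    dsimp only
    rw [← hA]
    have e : radialScale p N x ^ (-(1 / 2) : ℝ) * radialScale p N x ^ (1 / 2 : ℝ) = 1 := by
      rw [← rpow_add hx]; norm_num
    have e' : A * A⁻¹ = 1 := mul_inv_cancel₀ hA0.ne'
    generalize φ (R * radialScale p N x ^ ((p + 3) / 4)) = F
    linear_combination (A * A⁻¹ * F) * e + F * e'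

end VortexProfile

lemma exists_radialScale_eq {p N R r : ℝ} (hp : 1 < p) (hN : 0 < N) (hR : 0 < R) (hr : 0 < r) :
    ∃ x, 0 < radialScale p N x ∧ R * radialScale p N x ^ ((p + 3) / 4) = r := by
  have hp3 : 0 < p + 3 := by linarith
  have e : radialScale p N (N * (p + 3) / 4 * ((r / R) ^ (4 / (p + 3)) - 1))
      = (r / R) ^ (4 / (p + 3)) := by
    unfold radialScale
    field_simp
    ring
  refine ⟨N * (p + 3) / 4 * ((r / R) ^ (4 / (p + 3)) - 1), ?_, ?_⟩
  · rw [e]; positivity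
  · rw [e, ← rpow_mul (by positivity)]
    have : 4 / (p + 3) * ((p + 3) / 4) = 1 := by field_simp
    rw [this, rpow_one]
    field_simp

theorem stmt16 (p ω : ℝ) (hp : 1 < p) (hω : 0 < ω)
    (c : ℝ) (hc : c = (p + 3) * ω / 4) :
    ∃ mstar : ℕ, ∃ C > (0:ℝ), ∀ m : ℕ, mstar ≤ m →
      ∀ φ : ℝ → ℝ, ContDiffOn ℝ 2 φ (Set.Ioi 0) →
      (∀ r ∈ Set.Ioi (0:ℝ), 0 < φ r) →
      (∀ r ∈ Set.Ioi (0:ℝ),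
        deriv (deriv φ) r + deriv φ r / r - (ω + (m : ℝ) ^ 2 / r ^ 2) * φ r
          + φ r ^ p = 0) →
      (∃ L : ℝ,
        Tendsto (fun r => φ r / r ^ m) (nhdsWithin 0 (Set.Ioi 0)) (nhds L) ∧
        Tendsto (fun r => deriv φ r / ((m : ℝ) * r ^ (m - 1)))
          (nhdsWithin 0 (Set.Ioi 0)) (nhds L)) →
      Tendsto φ atTop (nhds 0) →
      ∀ r ∈ Set.Ioi (0:ℝ),
        |φ r - Qc p c (r - 2 * (m : ℝ) / Real.sqrt ((p - 1) * ω))| ≤ C / m := by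
  obtain ⟨C, hC, N₁, hN₁, hmain⟩ := exists_radialProfile_sub_Qc_le hp hω
  refine ⟨max 1 ⌈2 * N₁⌉₊, 2 * C, by positivity,
    fun m hm φ hφ hpos hode hlim htop r hr => ?_⟩
  have hm1 : 1 ≤ m := (le_max_left _ _).trans hm
  have hm0 : (0 : ℝ) < m := by exact_mod_cast hm1
  have hm2 : 2 * N₁ ≤ m := (Nat.le_ceil _).trans (by exact_mod_cast (le_max_right _ _).trans hm)
  have hder : ContDiffOn ℝ 1 (deriv φ) (Set.Ioi 0) :=
    ((contDiffOn_succ_iff_deriv_of_isOpen (n := 1) isOpen_Ioi).1 hφ).2.2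
  obtain ⟨L, hL, -⟩ := hlim
  have H : VortexProfile p ω m φ (deriv φ) :=
    { one_lt := hp
      omega_pos := hω
      one_le := hm1
      hasDerivAt := fun r hr =>
        ((hφ.differentiableOn (by norm_num)).differentiableAt (Ioi_mem_nhds hr)).hasDerivAt
      hasDerivAt' := fun r hr => by
        refine ((hder.differentiableOn (by norm_num)).differentiableAt
          (Ioi_mem_nhds hr)).hasDerivAt.congr_deriv ?_
        linarith [hode r hr]
      pos := fun r hr => hpos r hr
      near_zero := ⟨L, hL⟩
      at_top := htop }
  obtain ⟨N, l, R, hR, hN0, hNm, hlN, hlm, U, U1, hU, hUφ⟩ := H.exists_radialProfile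
  obtain ⟨x, hx, hxr⟩ := exists_radialScale_eq hp hN0 hR hr
  have h := hmain N l R m U U1 hU hR hm0.le (by linarith) hlN hlm x hx
  rw [hUφ x hx, hxr, ← hc] at h
  refine h.trans ?_
  rw [div_le_div_iff₀ hN0 hm0]
  nlinarith
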